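/- arXiv:1112.6143 — 3 statements merged into one kernel-verified Lean document; each statement's English description precedes it below -/
import Mathlib

section
/- Let U ⊆ ℝⁿ (n ≥ 2) be open and connected, and let (g, ω) and (ḡ, ω̄) be Randers data on U which are pointwise projectively related, i.e. every forward Randers geodesic of (g, ω) is either a forward Randers geodesic of (ḡ, ω̄) or a forward Randers geodesic of (ḡ, −ω̄), and conversely every forward Randers geodesic of (ḡ, ω̄) is either a forward Randers geodesic of (g, ω) or a forward Randers geodesic of (g, −ω). Then the set of points of U at which dω does not vanish equals the set of points of U at which dω̄ does not vanish: { p ∈ U : (dω)_p ≠ 0 } = { p ∈ U : (dω̄)_p ≠ 0 }. -/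
open Matrix

/-- The partial derivative `∂f/∂x^k` of a scalar function on `ℝⁿ` at a point `p`. -/
noncomputable def dpart {n : ℕ} (f : (Fin n → ℝ) → ℝ) (k : Fin n) (p : Fin n → ℝ) : ℝ :=
  fderiv ℝ f p (Pi.single k 1)

/-- The differential `dω` of a 1-form `ω` (given by its components), as a
skew-symmetric-matrix-valued map: `(dω)_{ik} = ∂ω_i/∂x^k − ∂ω_k/∂x^i`. -/
noncomputable def dform {n : ℕ} (ω : (Fin n → ℝ) → (Fin n → ℝ)) (p : Fin n → ℝ) :
    Matrix (Fin n) (Fin n) ℝ :=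
  Matrix.of fun i k => dpart (fun q => ω q i) k p - dpart (fun q => ω q k) i p

/-- The 1-form `ω` is closed on `U`. -/
def IsClosedFormOn {n : ℕ} (U : Set (Fin n → ℝ)) (ω : (Fin n → ℝ) → (Fin n → ℝ)) : Prop :=
  ∀ p ∈ U, dform ω p = 0

/-- `(g, ω)` is a Randers datum on `U`: `g` is a `C²` field of symmetric positive-definite
matrices and `ω` is a `C²` field of components of a 1-form. -/
def IsRandersDatum {n : ℕ} (U : Set (Fin n → ℝ))
    (g : (Fin n → ℝ) → Matrix (Fin n) (Fin n) ℝ)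
    (ω : (Fin n → ℝ) → (Fin n → ℝ)) : Prop :=
  (∀ p ∈ U, (g p).IsSymm ∧ (g p).PosDef) ∧
  (∀ i j, ContDiffOn ℝ 2 (fun q => g q i j) U) ∧
  (∀ i, ContDiffOn ℝ 2 (fun q => ω q i) U)

/-- `x : I → U` is a forward Randers geodesic of `(g, ω)`: `I` is an open interval, `x` is a
`C²` curve in `U` with nowhere-vanishing derivative satisfying the Euler–Lagrange equation of
the Randers length functional. -/
def IsRandersGeodesic {n : ℕ} (U : Set (Fin n → ℝ))
    (g : (Fin n → ℝ) → Matrix (Fin n) (Fin n) ℝ)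
    (ω : (Fin n → ℝ) → (Fin n → ℝ))
    (I : Set ℝ) (x : ℝ → (Fin n → ℝ)) : Prop :=
  IsOpen I ∧ I.OrdConnected ∧ (∀ t ∈ I, x t ∈ U) ∧
  ContDiffOn ℝ 2 x I ∧ (∀ t ∈ I, deriv x t ≠ 0) ∧
  ∀ t ∈ I, ∀ j : Fin n,
    deriv (deriv x) t j / Real.sqrt (∑ k, ∑ m, g (x t) k m * deriv x t k * deriv x t m)
    + deriv x t j *
        deriv (fun s => 1 / Real.sqrt (∑ k, ∑ m, g (x s) k m * deriv x s k * deriv x s m)) t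
    + (1 / Real.sqrt (∑ k, ∑ m, g (x t) k m * deriv x t k * deriv x t m)) *
        ∑ i, ∑ k, ∑ p, (g (x t))⁻¹ j i * dpart (fun q => g q i p) k (x t) *
          deriv x t k * deriv x t p
    + ∑ i, ∑ k, (g (x t))⁻¹ j i *
        (dpart (fun q => ω q i) k (x t) - dpart (fun q => ω q k) i (x t)) * deriv x t k
    - (1 / (2 * Real.sqrt (∑ k, ∑ m, g (x t) k m * deriv x t k * deriv x t m))) *
        ∑ i, ∑ p, ∑ q, (g (x t))⁻¹ j i * dpart (fun r => g r p q) i (x t) *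
          deriv x t p * deriv x t q
    = 0

open Set Topology

section Smoothness

variable {E : Type*} [NormedAddCommGroup E] [NormedSpace ℝ E] {n : ℕ}

theorem contDiffAt_det {k : WithTop ℕ∞} {A : E → Matrix (Fin n) (Fin n) ℝ} {z : E}
    (hA : ∀ i j, ContDiffAt ℝ k (fun y => A y i j) z) :
    ContDiffAt ℝ k (fun y => (A y).det) z := by
  simp only [Matrix.det_apply']
  exact ContDiffAt.sum fun σ _ => contDiffAt_const.mul (contDiffAt_prod fun i _ => hA _ _)

theorem contDiffAt_matrix_inv {k : WithTop ℕ∞} {A : E → Matrix (Fin n) (Fin n) ℝ} {z : E}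
    (hA : ∀ i j, ContDiffAt ℝ k (fun y => A y i j) z) (hdet : (A z).det ≠ 0) (i j : Fin n) :
    ContDiffAt ℝ k (fun y => (A y)⁻¹ i j) z := by
  simp only [Matrix.inv_def, Matrix.smul_apply, Ring.inverse_eq_inv', smul_eq_mul,
    Matrix.adjugate_apply]
  refine ((contDiffAt_det hA).inv hdet).mul (contDiffAt_det fun r s => ?_)
  by_cases hr : r = j
  · subst hr
    simpa using contDiffAt_const
  · simpa [Matrix.updateRow_ne hr] using hA r s

theorem contDiffAt_dpart {f : (Fin n → ℝ) → ℝ} {p : Fin n → ℝ} (hf : ContDiffAt ℝ 2 f p)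
    (k : Fin n) : ContDiffAt ℝ 1 (dpart f k) p :=
  (hf.fderiv_right (m := 1) (by norm_num)).clm_apply contDiffAt_const

theorem fderiv_apply_eq_sum_dpart (f : (Fin n → ℝ) → ℝ) (p v : Fin n → ℝ) :
    fderiv ℝ f p v = ∑ k, dpart f k p * v k := by
  conv_lhs => rw [pi_eq_sum_univ' v]
  simp only [map_sum, map_smul, smul_eq_mul, dpart, mul_comm]

end Smoothness

section Spray

variable {n : ℕ} {U : Set (Fin n → ℝ)} {g : (Fin n → ℝ) → Matrix (Fin n) (Fin n) ℝ}
  {ω : (Fin n → ℝ) → (Fin n → ℝ)}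

/-- The squared length `∑ A_{km} v^k v^m`. -/
noncomputable def speedSq (A : Matrix (Fin n) (Fin n) ℝ) (v : Fin n → ℝ) : ℝ :=
  ∑ k, ∑ m, A k m * v k * v m

/-- The Christoffel term of the geodesic equation of `g`, with lowered index. -/
noncomputable def metricForce (g : (Fin n → ℝ) → Matrix (Fin n) (Fin n) ℝ)
    (p v : Fin n → ℝ) : Fin n → ℝ := fun i =>
  ∑ k, ∑ q, dpart (fun r => g r i q) k p * v k * v q
    - 1 / 2 * ∑ k, ∑ q, dpart (fun r => g r k q) i p * v k * v q

/-- The acceleration of a constant-speed Randers geodesic at `p` with velocity `v`. -/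
noncomputable def randersSpray (g : (Fin n → ℝ) → Matrix (Fin n) (Fin n) ℝ)
    (ω : (Fin n → ℝ) → (Fin n → ℝ)) (p v : Fin n → ℝ) : Fin n → ℝ :=
  -((g p)⁻¹ *ᵥ (metricForce g p v + √(speedSq (g p) v) • (dform ω p *ᵥ v)))

theorem speedSq_eq_dotProduct (A : Matrix (Fin n) (Fin n) ℝ) (v : Fin n → ℝ) :
    speedSq A v = v ⬝ᵥ (A *ᵥ v) := by
  simp only [speedSq, dotProduct, mulVec, Finset.mul_sum]
  exact Finset.sum_congr rfl fun k _ => Finset.sum_congr rfl fun m _ => by ring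

theorem speedSq_pos {A : Matrix (Fin n) (Fin n) ℝ} (hA : A.PosDef) {v : Fin n → ℝ} (hv : v ≠ 0) :
    0 < speedSq A v := by
  simpa [speedSq_eq_dotProduct] using hA.dotProduct_mulVec_pos hv

theorem speedSq_neg (A : Matrix (Fin n) (Fin n) ℝ) (v : Fin n → ℝ) :
    speedSq A (-v) = speedSq A v := by
  simp [speedSq]

theorem metricForce_neg (g : (Fin n → ℝ) → Matrix (Fin n) (Fin n) ℝ) (p v : Fin n → ℝ) :
    metricForce g p (-v) = metricForce g p v := by
  ext i
  simp [metricForce]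

theorem dform_neg (ω : (Fin n → ℝ) → (Fin n → ℝ)) (p : Fin n → ℝ) :
    dform (fun q => -(ω q)) p = -dform ω p := by
  ext i k
  simp only [dform, dpart, of_apply, Pi.neg_apply, fderiv_fun_neg, Matrix.neg_apply,
    _root_.neg_apply]
  ring

theorem dotProduct_dform_mulVec (ω : (Fin n → ℝ) → (Fin n → ℝ)) (p v : Fin n → ℝ) :
    v ⬝ᵥ (dform ω p *ᵥ v) = 0 := by
  have hskew : (dform ω p)ᵀ = -dform ω p := by
    ext i k
    simp [dform]
  have h : v ⬝ᵥ (dform ω p *ᵥ v) = -(v ⬝ᵥ (dform ω p *ᵥ v)) := by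
    conv_lhs => rw [dotProduct_mulVec, ← mulVec_transpose, hskew, neg_mulVec, neg_dotProduct,
      dotProduct_comm]
  linarith

theorem isUnit_det_of_posDef {A : Matrix (Fin n) (Fin n) ℝ} (hA : A.PosDef) : IsUnit A.det :=
  (Matrix.isUnit_iff_isUnit_det A).1 hA.isUnit

theorem mulVec_randersSpray {p : Fin n → ℝ} (hg : (g p).PosDef) (v : Fin n → ℝ) :
    g p *ᵥ randersSpray g ω p v
      = -(metricForce g p v + √(speedSq (g p) v) • (dform ω p *ᵥ v)) := by
  rw [randersSpray, mulVec_neg, mulVec_mulVec, mul_nonsing_inv _ (isUnit_det_of_posDef hg),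
    one_mulVec]

theorem contDiffAt_randersSpray (hU : IsOpen U) (h : IsRandersDatum U g ω) {p v : Fin n → ℝ}
    (hp : p ∈ U) (hv : v ≠ 0) :
    ContDiffAt ℝ 1 (fun z : (Fin n → ℝ) × (Fin n → ℝ) => (z.2, randersSpray g ω z.1 z.2))
      (p, v) := by
  obtain ⟨hpos, hgs, hωs⟩ := h
  have hg2 (i j) : ContDiffAt ℝ 2 (fun q => g q i j) p := (hgs i j).contDiffAt (hU.mem_nhds hp)
  have hω2 (i) : ContDiffAt ℝ 2 (fun q => ω q i) p := (hωs i).contDiffAt (hU.mem_nhds hp)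
  have lift {f : (Fin n → ℝ) → ℝ} (hf : ContDiffAt ℝ 1 f p) :
      ContDiffAt ℝ 1 (fun z : (Fin n → ℝ) × (Fin n → ℝ) => f z.1) (p, v) :=
    ContDiffAt.comp (p, v) (g := f) hf contDiffAt_fst
  have hgz (i j) : ContDiffAt ℝ 1 (fun z : (Fin n → ℝ) × (Fin n → ℝ) => g z.1 i j) (p, v) :=
    lift ((hg2 i j).of_le (by norm_num))
  have hgd (i j k) := lift (contDiffAt_dpart (hg2 i j) k)
  have hωd (i k) := lift (contDiffAt_dpart (hω2 i) k)
  have hvz (k) : ContDiffAt ℝ 1 (fun z : (Fin n → ℝ) × (Fin n → ℝ) => z.2 k) (p, v) :=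
    contDiffAt_pi.1 contDiffAt_snd k
  have hsq : ContDiffAt ℝ 1
      (fun z : (Fin n → ℝ) × (Fin n → ℝ) => √(speedSq (g z.1) z.2)) (p, v) :=
    ContDiffAt.sqrt (ContDiffAt.sum fun k _ => ContDiffAt.sum fun m _ =>
      ((hgz k m).mul (hvz k)).mul (hvz m)) (speedSq_pos (hpos p hp).2 hv).ne'
  refine contDiffAt_snd.prodMk (contDiffAt_pi.2 fun j => ?_)
  simp only [randersSpray, Pi.neg_apply, mulVec, dotProduct, Pi.add_apply, Pi.smul_apply,
    smul_eq_mul, metricForce, dform, of_apply]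
  refine (ContDiffAt.sum fun i _ => ContDiffAt.mul ?_ (ContDiffAt.add (ContDiffAt.sub ?_ ?_)
    (hsq.mul ?_))).neg
  · exact contDiffAt_matrix_inv hgz (isUnit_det_of_posDef (hpos p hp).2).ne_zero j i
  · exact ContDiffAt.sum fun k _ => ContDiffAt.sum fun q _ =>
      ((hgd i q k).mul (hvz k)).mul (hvz q)
  · exact contDiffAt_const.mul (ContDiffAt.sum fun k _ => ContDiffAt.sum fun q _ =>
      ((hgd k q i).mul (hvz k)).mul (hvz q))
  · exact ContDiffAt.sum fun k _ => ((hωd i k).sub (hωd k i)).mul (hvz k)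

theorem hasDerivAt_speedSq_randersSpray (hU : IsOpen U) (h : IsRandersDatum U g ω)
    {x v : ℝ → (Fin n → ℝ)} {t : ℝ} (hxU : x t ∈ U) (hx : HasDerivAt x (v t) t)
    (hv : HasDerivAt v (randersSpray g ω (x t) (v t)) t) :
    HasDerivAt (fun s => speedSq (g (x s)) (v s)) 0 t := by
  obtain ⟨hpos, hgs, -⟩ := h
  set a := randersSpray g ω (x t) (v t) with ha
  have hgd (k m) : HasDerivAt (fun s => g (x s) k m)
      (∑ l, dpart (fun q => g q k m) l (x t) * v t l) t := by
    rw [← fderiv_apply_eq_sum_dpart (fun q => g q k m)]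
    have hd : DifferentiableAt ℝ (fun q => g q k m) (x t) :=
      ((hgs k m).contDiffAt (hU.mem_nhds hxU)).differentiableAt (by norm_num)
    exact hd.hasFDerivAt.comp_hasDerivAt t hx
  have hvd := hasDerivAt_pi.1 hv
  have hN := HasDerivAt.fun_sum (u := Finset.univ) fun k _ =>
    HasDerivAt.fun_sum (u := Finset.univ) fun m _ => ((hgd k m).fun_mul (hvd k)).fun_mul (hvd m)
  refine hN.congr_deriv ?_
  have hcov := mulVec_randersSpray (ω := ω) (hpos _ hxU).2 (v t)
  rw [← ha] at hcov
  have hdot : v t ⬝ᵥ (g (x t) *ᵥ a) = -(v t ⬝ᵥ metricForce g (x t) (v t)) := by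
    rw [hcov, dotProduct_neg, dotProduct_add, dotProduct_smul, dotProduct_dform_mulVec]
    simp
  have hdot' : a ⬝ᵥ (g (x t) *ᵥ v t) = v t ⬝ᵥ (g (x t) *ᵥ a) := by
    rw [dotProduct_mulVec, ← mulVec_transpose, (hpos _ hxU).1, dotProduct_comm]
  set T := ∑ k, ∑ m, ∑ l, dpart (fun q => g q k m) l (x t) * v t l * v t k * v t m with hT
  have hforce : v t ⬝ᵥ metricForce g (x t) (v t) = T - 1 / 2 * T := by
    simp only [dotProduct, metricForce, mul_sub, Finset.sum_sub_distrib, Finset.mul_sum, hT]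
    congr 1
    · refine Finset.sum_congr rfl fun k _ => ?_
      rw [Finset.sum_comm]
      exact Finset.sum_congr rfl fun m _ => Finset.sum_congr rfl fun l _ => by ring
    · rw [Finset.sum_comm]
      refine Finset.sum_congr rfl fun k _ => ?_
      rw [Finset.sum_comm]
      exact Finset.sum_congr rfl fun m _ => Finset.sum_congr rfl fun l _ => by ring
  have hsum : T + a ⬝ᵥ (g (x t) *ᵥ v t) + v t ⬝ᵥ (g (x t) *ᵥ a) = 0 := by
    rw [hdot', hdot, hforce]
    ring
  rw [← hsum]
  simp only [hT, dotProduct, mulVec, Finset.mul_sum, Finset.sum_mul, ← Finset.sum_add_distrib]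
  refine Finset.sum_congr rfl fun k _ => Finset.sum_congr rfl fun m _ => ?_
  simp only [← Finset.sum_mul]
  ring

theorem eulerLagrange_eq (A B : Matrix (Fin n) (Fin n) ℝ) (p v a : Fin n → ℝ) (c s : ℝ)
    (j : Fin n) :
    a j / s + v j * c
      + 1 / s * ∑ i, ∑ k, ∑ q, A j i * dpart (fun r => g r i q) k p * v k * v q
      + ∑ i, ∑ k, A j i * B i k * v k
      - 1 / (2 * s) * ∑ i, ∑ k, ∑ q, A j i * dpart (fun r => g r k q) i p * v k * v q
    = a j / s + v j * c + (A *ᵥ metricForce g p v) j / s + (A *ᵥ (B *ᵥ v)) j := by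
  have h1 : (A *ᵥ metricForce g p v) j
      = ∑ i, ∑ k, ∑ q, A j i * dpart (fun r => g r i q) k p * v k * v q
        - 1 / 2 * ∑ i, ∑ k, ∑ q, A j i * dpart (fun r => g r k q) i p * v k * v q := by
    simp only [mulVec, dotProduct, metricForce, mul_sub, Finset.sum_sub_distrib, Finset.mul_sum]
    congr 1 <;>
    exact Finset.sum_congr rfl fun i _ => Finset.sum_congr rfl fun k _ =>
      Finset.sum_congr rfl fun q _ => by ring
  have h2 : (A *ᵥ (B *ᵥ v)) j = ∑ i, ∑ k, A j i * B i k * v k := by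
    simp only [mulVec, dotProduct, Finset.mul_sum, mul_assoc]
  have h3 : 1 / (2 * s) = 1 / s * (1 / 2) := by ring
  rw [h1, h2, h3]
  ring

theorem exists_randersGeodesic (hU : IsOpen U) (h : IsRandersDatum U g ω) {p v : Fin n → ℝ}
    (hp : p ∈ U) (hv : v ≠ 0) :
    ∃ (I : Set ℝ) (x : ℝ → (Fin n → ℝ)), IsRandersGeodesic U g ω I x ∧ (0 : ℝ) ∈ I ∧ x 0 = p ∧
      deriv x 0 = v ∧ deriv (deriv x) 0 = randersSpray g ω p v := by
  obtain ⟨α, hα0, ε, hε, hα⟩ :=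
    ContDiffAt.exists_forall_mem_closedBall_exists_eq_forall_mem_Ioo_hasDerivAt₀
      (contDiffAt_randersSpray hU h hp hv) 0
  rw [zero_sub, zero_add] at hα
  have hcont : ContinuousAt α 0 := (hα 0 ⟨by linarith, hε⟩).continuousAt
  have hev : ∀ᶠ t in 𝓝 (0 : ℝ), (α t).1 ∈ U ∧ (α t).2 ≠ 0 := by
    refine (hcont.fst.eventually_mem (hU.mem_nhds ?_)).and (hcont.snd.eventually_ne ?_)
    · simpa [hα0] using hp
    · simpa [hα0] using hv
  obtain ⟨δ, hδ, hball⟩ := Metric.eventually_nhds_iff_ball.1 hev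
  set η := min ε δ
  have hη : 0 < η := lt_min hε hδ
  set I : Set ℝ := Ioo (-η) η with hI
  have hIε {t} (ht : t ∈ I) : t ∈ Ioo (-ε) ε :=
    ⟨by linarith [ht.1, min_le_left ε δ], by linarith [ht.2, min_le_left ε δ]⟩
  have hIδ {t} (ht : t ∈ I) : (α t).1 ∈ U ∧ (α t).2 ≠ 0 := by
    refine hball t ?_
    rw [Metric.mem_ball, Real.dist_eq, sub_zero, abs_lt]
    exact ⟨by linarith [ht.1, min_le_right ε δ], by linarith [ht.2, min_le_right ε δ]⟩
  have hIo : IsOpen I := isOpen_Ioo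
  set x : ℝ → (Fin n → ℝ) := fun t => (α t).1
  set w : ℝ → (Fin n → ℝ) := fun t => (α t).2
  have hx {t} (ht : t ∈ I) : HasDerivAt x (w t) t := (hα t (hIε ht)).fst
  have hw {t} (ht : t ∈ I) : HasDerivAt w (randersSpray g ω (x t) (w t)) t :=
    (hα t (hIε ht)).snd
  have hdx : EqOn (deriv x) w I := fun t ht => (hx ht).deriv
  have hdxe {t} (ht : t ∈ I) : deriv x =ᶠ[𝓝 t] w := hdx.eventuallyEq_of_mem (hIo.mem_nhds ht)
  have hddx {t} (ht : t ∈ I) : deriv (deriv x) t = randersSpray g ω (x t) (w t) := by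
    rw [(hdxe ht).deriv_eq, (hw ht).deriv]
  have h0 : (0 : ℝ) ∈ I := ⟨by linarith, hη⟩
  have hx0 : x 0 = p := by simp [x, hα0]
  have hw0 : w 0 = v := by simp [w, hα0]
  refine ⟨I, x, ⟨hIo, ordConnected_Ioo, fun t ht => (hIδ ht).1, ?_, ?_, ?_⟩, h0, hx0, ?_, ?_⟩
  · have h2 : (2 : WithTop ℕ∞) = 1 + 1 := by norm_num
    have h1 : (1 : WithTop ℕ∞) = 0 + 1 := by norm_num
    have hw1 : ContDiffOn ℝ 1 w I := by
      rw [h1, contDiffOn_succ_iff_deriv_of_isOpen hIo]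
      refine ⟨fun t ht => (hw ht).differentiableAt.differentiableWithinAt, by simp, ?_⟩
      rw [contDiffOn_zero]
      have hs : ContinuousOn (fun t => randersSpray g ω (x t) (w t)) I := fun t ht => by
        have hc : ContinuousAt
            (fun z : (Fin n → ℝ) × (Fin n → ℝ) => randersSpray g ω z.1 z.2) (α t) :=
          (contDiffAt_randersSpray hU h (hIδ ht).1 (hIδ ht).2).continuousAt.snd
        exact (hc.comp (hα t (hIε ht)).continuousAt).continuousWithinAt
      exact hs.congr fun t ht => (hw ht).deriv
    rw [h2, contDiffOn_succ_iff_deriv_of_isOpen hIo]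
    exact ⟨fun t ht => (hx ht).differentiableAt.differentiableWithinAt, by simp,
      hw1.congr hdx⟩
  · intro t ht
    rw [hdx ht]
    exact (hIδ ht).2
  · intro t ht j
    have hNpos : 0 < speedSq (g (x t)) (w t) := speedSq_pos (h.1 _ (hIδ ht).1).2 (hIδ ht).2
    have hN0 : deriv (fun s => 1 / √(∑ k, ∑ m, g (x s) k m * deriv x s k * deriv x s m)) t = 0 := by
      have heq : (fun s => 1 / √(∑ k, ∑ m, g (x s) k m * deriv x s k * deriv x s m))
          =ᶠ[𝓝 t] fun s => (√(speedSq (g (x s)) (w s)))⁻¹ := by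
        filter_upwards [hdxe ht] with s hs
        simp only [hs, one_div, speedSq]
      have hd := ((hasDerivAt_speedSq_randersSpray hU h (hIδ ht).1 (hx ht) (hw ht)).sqrt
        hNpos.ne').fun_inv (Real.sqrt_pos.2 hNpos).ne'
      rw [heq.deriv_eq]
      simpa using hd.deriv
    refine (eulerLagrange_eq (g := g) (g (x t))⁻¹ (dform ω (x t)) (x t) (deriv x t)
      (deriv (deriv x) t) _ _ j).trans ?_
    rw [hN0, hdx ht, hddx ht]
    change _ / √(speedSq (g (x t)) (w t)) + _ + _ / √(speedSq (g (x t)) (w t)) + _ = 0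
    have hs := (Real.sqrt_pos.2 hNpos).ne'
    simp only [randersSpray, mulVec_add, mulVec_smul, Pi.neg_apply, Pi.add_apply, Pi.smul_apply,
      smul_eq_mul]
    field_simp
    ring
  · rw [hdx h0, hw0]
  · rw [hddx h0, hx0, hw0]

theorem IsRandersGeodesic.exists_acceleration_eq {I : Set ℝ} {x : ℝ → (Fin n → ℝ)}
    (hx : IsRandersGeodesic U g ω I x) (hpos : ∀ p ∈ U, (g p).PosDef) {t : ℝ} (ht : t ∈ I)
    (hω : dform ω (x t) = 0) :
    ∃ c : ℝ, deriv (deriv x) t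
      = c • deriv x t - (g (x t))⁻¹ *ᵥ metricForce g (x t) (deriv x t) := by
  obtain ⟨-, -, hxU, -, hx0, hEL⟩ := hx
  have hs := Real.sqrt_pos.2 (speedSq_pos (hpos _ (hxU t ht)) (hx0 t ht))
  refine ⟨-(√(speedSq (g (x t)) (deriv x t)) *
    deriv (fun s => 1 / √(speedSq (g (x s)) (deriv x s))) t), ?_⟩
  ext j
  have hj := (eulerLagrange_eq (g := g) (g (x t))⁻¹ (dform ω (x t)) (x t) (deriv x t) (deriv (deriv x) t)
      (deriv (fun s => 1 / √(speedSq (g (x s)) (deriv x s))) t)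
      (√(speedSq (g (x t)) (deriv x t))) j).symm.trans (hEL t ht j)
  rw [hω, zero_mulVec, mulVec_zero, Pi.zero_apply, add_zero] at hj
  simp only [Pi.sub_apply, Pi.smul_apply, smul_eq_mul]
  field_simp at hj
  linarith

end Spray

theorem dform_eq_zero_of_projectively_related {n : ℕ} {U : Set (Fin n → ℝ)} (hU : IsOpen U)
    {g gbar : (Fin n → ℝ) → Matrix (Fin n) (Fin n) ℝ} {ω ωbar : (Fin n → ℝ) → (Fin n → ℝ)}
    (h : IsRandersDatum U g ω) (hbar : IsRandersDatum U gbar ωbar)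
    (hproj : ∀ (I : Set ℝ) (x : ℝ → (Fin n → ℝ)),
      IsRandersGeodesic U g ω I x →
        IsRandersGeodesic U gbar ωbar I x ∨
        IsRandersGeodesic U gbar (fun p => -(ωbar p)) I x)
    {p : Fin n → ℝ} (hp : p ∈ U) (hωbar : dform ωbar p = 0) : dform ω p = 0 := by
  have hspray (v : Fin n → ℝ) (hv : v ≠ 0) : ∃ c : ℝ,
      randersSpray g ω p v = c • v - (gbar p)⁻¹ *ᵥ metricForce gbar p v := by
    obtain ⟨I, x, hx, h0, hx0, hdx, hddx⟩ := exists_randersGeodesic hU h hp hv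
    rw [← hddx, ← hdx, ← hx0]
    rw [← hx0] at hωbar
    rcases hproj I x hx with hx' | hx'
    · exact hx'.exists_acceleration_eq (fun q hq => (hbar.1 q hq).2) h0 hωbar
    · exact hx'.exists_acceleration_eq (fun q hq => (hbar.1 q hq).2) h0
        (by rw [dform_neg, hωbar, neg_zero])
  have hdet := isUnit_det_of_posDef (h.1 p hp).2
  have hker (v : Fin n → ℝ) : dform ω p *ᵥ v = 0 := by
    by_cases hv : v = 0
    · rw [hv, mulVec_zero]
    obtain ⟨c, hc⟩ := hspray v hv
    obtain ⟨c', hc'⟩ := hspray (-v) (neg_ne_zero.2 hv)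
    have hN := speedSq_pos (h.1 p hp).2 hv
    have h1 := mulVec_randersSpray (ω := ω) (h.1 p hp).2 v
    have h2 := mulVec_randersSpray (ω := ω) (h.1 p hp).2 (-v)
    rw [metricForce_neg, speedSq_neg, mulVec_neg] at h2
    rw [metricForce_neg] at hc'
    set s := √(speedSq (g p) v)
    have hs : 0 < s := Real.sqrt_pos.2 hN
    have hdiff : (2 * s) • (dform ω p *ᵥ v) = -(c + c') • (g p *ᵥ v) := by
      have h3 : randersSpray g ω p v - randersSpray g ω p (-v) = (c + c') • v := by
        rw [hc, hc']
        module
      have h4 := congrArg (g p *ᵥ ·) h3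
      simp only [mulVec_sub, mulVec_smul, h1, h2] at h4
      rw [neg_smul, ← h4]
      module
    have hcc : c + c' = 0 := by
      have h5 := congrArg (v ⬝ᵥ ·) hdiff
      simp only [dotProduct_smul, dotProduct_dform_mulVec, smul_eq_mul, mul_zero] at h5
      rw [← speedSq_eq_dotProduct] at h5
      have := (mul_eq_zero.1 h5.symm).resolve_right hN.ne'
      linarith
    rw [hcc, neg_zero, zero_smul] at hdiff
    exact (smul_eq_zero.1 hdiff).resolve_left (by positivity)
  ext i k
  simpa using congrFun (hker (Pi.single k 1)) i

/-- For two pointwise projectively related Randers data, the set of points where `dω` does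
not vanish coincides with the set of points where `dω̄` does not vanish. -/
theorem stmt_14 (n : ℕ) (hn : 2 ≤ n) (U : Set (Fin n → ℝ))
    (hUopen : IsOpen U) (hUconn : IsConnected U)
    (g gbar : (Fin n → ℝ) → Matrix (Fin n) (Fin n) ℝ)
    (ω ωbar : (Fin n → ℝ) → (Fin n → ℝ))
    (hdatum : IsRandersDatum U g ω) (hdatumbar : IsRandersDatum U gbar ωbar)
    (hproj : ∀ (I : Set ℝ) (x : ℝ → (Fin n → ℝ)),
      IsRandersGeodesic U g ω I x →
        IsRandersGeodesic U gbar ωbar I x ∨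
        IsRandersGeodesic U gbar (fun p => -(ωbar p)) I x)
    (hprojback : ∀ (I : Set ℝ) (x : ℝ → (Fin n → ℝ)),
      IsRandersGeodesic U gbar ωbar I x →
        IsRandersGeodesic U g ω I x ∨
        IsRandersGeodesic U g (fun p => -(ω p)) I x) :
    {p | p ∈ U ∧ dform ω p ≠ 0} = {p | p ∈ U ∧ dform ωbar p ≠ 0} := by
  ext p
  refine and_congr_right fun hp => not_congr ⟨fun hω => ?_, fun hω => ?_⟩
  · exact dform_eq_zero_of_projectively_related hUopen hdatumbar hdatum hprojback hp hω
  · exact dform_eq_zero_of_projectively_related hUopen hdatum hdatumbar hproj hp hω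
end

section
/- (Corollary 1 of the paper, in coordinates.) Let U ⊆ ℝⁿ (n ≥ 2) be open and connected, let (g, ω) be a Randers datum on U, and let φ : U → U be a C³ diffeomorphism. Define the pullback data φ*g and φ*ω on U by (φ*g)(p) := (Dφ_p)ᵀ · g(φ(p)) · Dφ_p and (φ*ω)(p) := (Dφ_p)ᵀ · ω(φ(p)), where Dφ_p is the Jacobian matrix of φ at p. Suppose φ is a projective transformation of (g, ω), i.e. every forward Randers geodesic of (g, ω) is a forward Randers geodesic of (φ*g, φ*ω). If ω is not closed (dω is not identically zero on U), then φ is a homothety of g: there exists a real constant c > 0 such that (φ*g)(p) = c²·g(p) for every p ∈ U. -/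
open Matrix

/-- The Jacobian matrix of a map `φ : ℝⁿ → ℝⁿ` at a point `p`. -/
noncomputable def jacobian {n : ℕ} (φ : (Fin n → ℝ) → (Fin n → ℝ)) (p : Fin n → ℝ) :
    Matrix (Fin n) (Fin n) ℝ :=
  Matrix.of fun i j => dpart (fun q => φ q i) j p

section Algebra

variable {n : ℕ}

/-- The contraction `∑ₖ vᵏ Dₖ` of a family of matrices with a vector. -/
noncomputable def contractVec (D : Fin n → Matrix (Fin n) (Fin n) ℝ) (v : Fin n → ℝ) :
    Matrix (Fin n) (Fin n) ℝ :=
  ∑ k, v k • D k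

/-- The geodesic spray with its index lowered, for a metric with partial derivatives `D k`. -/
noncomputable def lowerSpray (D : Fin n → Matrix (Fin n) (Fin n) ℝ) (v : Fin n → ℝ) :
    Fin n → ℝ :=
  contractVec D v *ᵥ v - (1 / 2 : ℝ) • fun i => v ⬝ᵥ D i *ᵥ v

/-- The quadratic part `Γ(v, v)` of the geodesic equation of a metric `M` with partial
derivatives `D k`. -/
noncomputable def spray (M : Matrix (Fin n) (Fin n) ℝ) (D : Fin n → Matrix (Fin n) (Fin n) ℝ)
    (v : Fin n → ℝ) : Fin n → ℝ :=
  M⁻¹ *ᵥ lowerSpray D v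

lemma contractVec_apply (D : Fin n → Matrix (Fin n) (Fin n) ℝ) (v : Fin n → ℝ) (i j : Fin n) :
    contractVec D v i j = ∑ k, v k * D k i j := by
  simp [contractVec, Matrix.sum_apply]

lemma dotProduct_contractVec_mulVec (D : Fin n → Matrix (Fin n) (Fin n) ℝ) (u v w : Fin n → ℝ) :
    u ⬝ᵥ contractVec D v *ᵥ w = ∑ k, v k * (u ⬝ᵥ D k *ᵥ w) := by
  simp [contractVec, Matrix.sum_mulVec, dotProduct_sum, Matrix.smul_mulVec]

lemma contractVec_add (D : Fin n → Matrix (Fin n) (Fin n) ℝ) (u v : Fin n → ℝ) :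
    contractVec D (u + v) = contractVec D u + contractVec D v := by
  simp [contractVec, add_smul, Finset.sum_add_distrib]

lemma contractVec_smul (D : Fin n → Matrix (Fin n) (Fin n) ℝ) (a : ℝ) (v : Fin n → ℝ) :
    contractVec D (a • v) = a • contractVec D v := by
  simp [contractVec, Finset.smul_sum, smul_smul]

lemma lowerSpray_smul (D : Fin n → Matrix (Fin n) (Fin n) ℝ) (a : ℝ) (v : Fin n → ℝ) :
    lowerSpray D (a • v) = a ^ 2 • lowerSpray D v := by
  ext i
  simp only [lowerSpray, contractVec_smul, mulVec_smul, smul_mulVec, smul_dotProduct,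
    dotProduct_smul, Pi.sub_apply, Pi.smul_apply, smul_eq_mul]
  ring

lemma lowerSpray_parallelogram (D : Fin n → Matrix (Fin n) (Fin n) ℝ) (u v : Fin n → ℝ) :
    lowerSpray D (u + v) + lowerSpray D (u - v)
      = (2 : ℝ) • lowerSpray D u + (2 : ℝ) • lowerSpray D v := by
  have h : u - v = u + (-1 : ℝ) • v := by simp [sub_eq_add_neg]
  rw [h]
  ext i
  simp only [lowerSpray, contractVec_add, contractVec_smul, mulVec_smul, smul_mulVec,
    smul_dotProduct, mulVec_add, add_mulVec, dotProduct_add, add_dotProduct,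
    dotProduct_smul, Pi.sub_apply, Pi.add_apply, Pi.smul_apply, smul_eq_mul]
  ring

lemma spray_smul (M : Matrix (Fin n) (Fin n) ℝ) (D : Fin n → Matrix (Fin n) (Fin n) ℝ)
    (a : ℝ) (v : Fin n → ℝ) : spray M D (a • v) = a ^ 2 • spray M D v := by
  rw [spray, lowerSpray_smul, mulVec_smul, spray]

lemma spray_parallelogram (M : Matrix (Fin n) (Fin n) ℝ)
    (D : Fin n → Matrix (Fin n) (Fin n) ℝ) (u v : Fin n → ℝ) :
    spray M D (u + v) + spray M D (u - v) = (2 : ℝ) • spray M D u + (2 : ℝ) • spray M D v := by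
  simp only [spray, ← mulVec_smul, ← mulVec_add, lowerSpray_parallelogram]

lemma two_mul_dotProduct_spray {M : Matrix (Fin n) (Fin n) ℝ} (hM : IsUnit M.det)
    (D : Fin n → Matrix (Fin n) (Fin n) ℝ) (v : Fin n → ℝ) :
    2 * (v ⬝ᵥ M *ᵥ spray M D v) = v ⬝ᵥ contractVec D v *ᵥ v := by
  rw [spray, mulVec_mulVec, mul_nonsing_inv _ hM, one_mulVec, lowerSpray, dotProduct_sub,
    dotProduct_smul, dotProduct_contractVec_mulVec]
  simp only [dotProduct, smul_eq_mul]
  ring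

lemma sum_polar_spray {M : Matrix (Fin n) (Fin n) ℝ} (hM : M.IsSymm)
    {D : Fin n → Matrix (Fin n) (Fin n) ℝ} (hD : ∀ k, (D k).IsSymm) (v : Fin n → ℝ) :
    ∑ j, (spray M D (Pi.single j 1 + v) - spray M D (Pi.single j 1) - spray M D v) j
      = (M⁻¹ * contractVec D v).trace := by
  have hMi : ∀ i j, M⁻¹ i j = M⁻¹ j i := fun i j => by
    have : M⁻¹ᵀ = M⁻¹ := by rw [transpose_nonsing_inv, hM.eq]
    exact congrFun (congrFun this j) i
  have key : ∀ j i, (lowerSpray D (Pi.single j 1 + v) - lowerSpray D (Pi.single j 1)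
      - lowerSpray D v) i = contractVec D v i j + (∑ p, D j i p * v p - ∑ p, D i j p * v p) := by
    intro j i
    have h1 : v ⬝ᵥ D i *ᵥ Pi.single j 1 = Pi.single j 1 ⬝ᵥ D i *ᵥ v := by
      rw [dotProduct_mulVec, ← mulVec_transpose, (hD i).eq, dotProduct_comm]
    have h2 : contractVec D (Pi.single j 1) = D j := by
      ext a b
      simp [contractVec_apply, Pi.single_apply]
    simp only [lowerSpray, contractVec_add, mulVec_add, add_mulVec, dotProduct_add,
      add_dotProduct, Pi.sub_apply, Pi.add_apply, Pi.smul_apply, smul_eq_mul, h1, h2]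
    have h3 : Pi.single j 1 ⬝ᵥ D i *ᵥ v = ∑ p, D i j p * v p := by
      rw [single_one_dotProduct]; rfl
    have h4 : (D j *ᵥ v) i = ∑ p, D j i p * v p := rfl
    have h5 : (contractVec D v *ᵥ Pi.single j 1) i = contractVec D v i j := by
      simp
    rw [h3, h4, h5]
    ring
  have hs : ∀ j, (spray M D (Pi.single j 1 + v) - spray M D (Pi.single j 1) - spray M D v) j
      = ∑ i, M⁻¹ j i * contractVec D v i j
        + (∑ i, ∑ p, M⁻¹ j i * (D j i p * v p) - ∑ i, ∑ p, M⁻¹ j i * (D i j p * v p)) := by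
    intro j
    simp only [spray, ← mulVec_sub]
    simp only [mulVec, dotProduct, key, mul_add, mul_sub, Finset.sum_add_distrib,
      Finset.sum_sub_distrib, Finset.mul_sum]
  simp only [hs, Finset.sum_add_distrib, Finset.sum_sub_distrib]
  have hswap : ∑ j, ∑ i, ∑ p, M⁻¹ j i * (D j i p * v p)
      = ∑ j, ∑ i, ∑ p, M⁻¹ j i * (D i j p * v p) := by
    rw [Finset.sum_comm]
    refine Finset.sum_congr rfl fun i _ => Finset.sum_congr rfl fun j _ =>
      Finset.sum_congr rfl fun p _ => ?_
    rw [hMi]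
  rw [hswap, sub_self, add_zero]
  simp [trace, mul_apply]

/-- A quadratic map sending every vector to a multiple of itself is multiplication by a linear
form. -/
lemma exists_linear_factor {V : Type*} [AddCommGroup V] [Module ℝ V] (P : V → V)
    (hsmul : ∀ (a : ℝ) v, P (a • v) = a ^ 2 • P v)
    (hpar : ∀ u v, P (u + v) + P (u - v) = (2 : ℝ) • P u + (2 : ℝ) • P v)
    (h : ∀ v ≠ 0, ∃ c : ℝ, P v = c • v) :
    ∃ l : V →ₗ[ℝ] ℝ, ∀ v, P v = l v • v := by
  classical
  choose! c hc using h
  set l : V → ℝ := fun v => if v = 0 then 0 else c v with hl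
  have hP : ∀ v, P v = l v • v := by
    intro v
    by_cases hv : v = 0
    · have := hsmul 0 0
      simp [hv] at this ⊢
      exact this
    · simp [hl, hv, hc v hv]
  have hls : ∀ (a : ℝ) v, l (a • v) = a * l v := by
    intro a v
    by_cases ha : a = 0
    · simp [ha, hl]
    by_cases hv : v = 0
    · simp [hv, hl]
    have h1 := hsmul a v
    rw [hP, hP, smul_smul, smul_smul] at h1
    have h2 := smul_left_injective ℝ hv h1
    have : a * (l (a • v) - a * l v) = 0 := by linear_combination h2
    rcases mul_eq_zero.1 this with h3 | h3
    · exact absurd h3 ha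
    · linarith
  have hadd : ∀ u v, l (u + v) = l u + l v := by
    intro u v
    by_cases hu : u = 0
    · simp [hu, hl]
    by_cases hi : ∃ a : ℝ, a • u = v
    · obtain ⟨a, rfl⟩ := hi
      have : u + a • u = (1 + a) • u := by rw [add_smul, one_smul]
      rw [this, hls, hls]
      ring
    · push Not at hi
      have hind := LinearIndependent.pair_iff.1 ((LinearIndependent.pair_iff' hu).2 hi)
      have h1 := hpar u v
      rw [hP, hP, hP u, hP v] at h1
      have h2 : (l (u + v) + l (u - v) - 2 * l u) • u
          + (l (u + v) - l (u - v) - 2 * l v) • v = 0 := by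
        rw [← sub_eq_zero] at h1
        rw [← h1]
        module
      obtain ⟨h3, h4⟩ := hind _ _ h2
      linarith
  exact ⟨{ toFun := l, map_add' := hadd, map_smul' := hls }, hP⟩

lemma sum_polar_of_linear_factor {P : (Fin n → ℝ) → Fin n → ℝ} (l : (Fin n → ℝ) →ₗ[ℝ] ℝ)
    (hP : ∀ v, P v = l v • v) (v : Fin n → ℝ) :
    ∑ j, (P (Pi.single j 1 + v) - P (Pi.single j 1) - P v) j = (n + 1) * l v := by
  have h1 : ∀ j, (P (Pi.single j 1 + v) - P (Pi.single j 1) - P v) j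
      = v j * l (Pi.single j 1) + l v := by
    intro j
    simp only [hP, map_add, Pi.sub_apply, Pi.smul_apply, Pi.add_apply, Pi.single_eq_same,
      smul_eq_mul]
    ring
  have h2 : ∑ j, v j * l (Pi.single j 1) = l v := by
    conv_rhs => rw [pi_eq_sum_univ' v]
    simp [map_sum]
  simp only [h1, Finset.sum_add_distrib, h2]
  simp
  ring

lemma Matrix.IsSymm.eq_zero_of_quadratic_eq_zero {A : Matrix (Fin n) (Fin n) ℝ} (hA : A.IsSymm)
    (h : ∀ v, v ⬝ᵥ A *ᵥ v = 0) : A = 0 := by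
  ext i j
  have h1 := h (Pi.single i 1 + Pi.single j 1)
  have h2 := h (Pi.single i 1)
  have h3 := h (Pi.single j 1)
  have h4 : A j i = A i j := hA.apply i j
  simp [mulVec_add, add_dotProduct] at h1 h2 h3
  rw [Matrix.zero_apply]
  linarith

lemma quadratic_add_smul (A : Matrix (Fin n) (Fin n) ℝ) (v u : Fin n → ℝ) (s : ℝ) :
    (v + s • u) ⬝ᵥ A *ᵥ (v + s • u)
      = v ⬝ᵥ A *ᵥ v + (v ⬝ᵥ A *ᵥ u + u ⬝ᵥ A *ᵥ v) * s + u ⬝ᵥ A *ᵥ u * s ^ 2 := by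
  simp only [mulVec_add, mulVec_smul, dotProduct_add, add_dotProduct, smul_dotProduct,
    dotProduct_smul, smul_eq_mul]
  ring

lemma Matrix.IsSymm.eq_zero_of_eventually_quadratic_eq_zero {A : Matrix (Fin n) (Fin n) ℝ}
    (hA : A.IsSymm) {v : Fin n → ℝ} (h : ∀ᶠ w in nhds v, w ⬝ᵥ A *ᵥ w = 0) : A = 0 := by
  refine Matrix.IsSymm.eq_zero_of_quadratic_eq_zero hA fun u => ?_
  have hc : ∀ e : ℝ, Filter.Tendsto (fun s : ℝ => v + (e * s) • u) (nhds 0) (nhds v) := by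
    intro e
    have : Continuous fun s : ℝ => v + (e * s) • u := by fun_prop
    simpa using this.tendsto 0
  have h1 := ((hc 1).eventually h).and ((hc (-1)).eventually h)
  obtain ⟨s, hs, hs0⟩ := ((h1.filter_mono nhdsWithin_le_nhds).and
    (self_mem_nhdsWithin : Set.Ioi (0 : ℝ) ∈ nhdsWithin 0 (Set.Ioi 0))).exists
  have h0 := h.self_of_nhds
  obtain ⟨h2, h3⟩ := hs
  rw [quadratic_add_smul, h0] at h2 h3
  have : u ⬝ᵥ A *ᵥ u * s ^ 2 = 0 := by linarith
  rcases mul_eq_zero.1 this with h4 | h4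
  · exact h4
  · exact absurd h4 (pow_ne_zero 2 (ne_of_gt hs0))

end Algebra
section Proportional

variable {n : ℕ}

open Polynomial in
/-- If `p a² = q b²` for real polynomials of degree at most two, where `p` and `q` have no real
roots and `a ≠ 0`, then `q` is a multiple of `p`. -/
lemma Polynomial.exists_eq_C_mul_of_mul_sq_eq {p q a b : ℝ[X]} (hp : p.natDegree = 2)
    (hq : q.natDegree = 2) (ha : a.natDegree ≤ 2) (hb : b.natDegree ≤ 2)
    (hpr : ∀ x, ¬ p.IsRoot x) (ha0 : a ≠ 0) (h : p * a ^ 2 = q * b ^ 2) :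
    ∃ k : ℝ, q = C k * p := by
  have hirr : Irreducible p := irreducible_of_degree_le_three_of_not_isRoot (by simp [hp]) hpr
  have hp0 : p ≠ 0 := hirr.ne_zero
  have hC : ∀ r : ℝ[X], r.natDegree ≤ 2 → p ∣ r → ∃ k : ℝ, r = C k * p := by
    rintro r hr ⟨s, rfl⟩
    by_cases hs : s = 0
    · exact ⟨0, by simp [hs]⟩
    rw [natDegree_mul hp0 hs, hp] at hr
    rw [eq_C_of_natDegree_eq_zero (p := s) (by omega)]
    exact ⟨s.coeff 0, mul_comm _ _⟩
  rcases hirr.prime.dvd_or_dvd (a := q) (b := b ^ 2) (h ▸ dvd_mul_right _ _) with h1 | h1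
  · exact hC q hq.le h1
  · obtain ⟨β, rfl⟩ := hC b hb (hirr.prime.dvd_of_dvd_pow h1)
    have h2 : a ^ 2 = C (β ^ 2) * q * p := by
      apply mul_left_cancel₀ hp0
      rw [h, C_pow]
      ring
    obtain ⟨γ, rfl⟩ := hC a ha (hirr.prime.dvd_of_dvd_pow (h2 ▸ dvd_mul_left _ _))
    have h3 : C (γ ^ 2) * p = C (β ^ 2) * q := by
      apply mul_right_cancel₀ hp0
      rw [← h2, C_pow]
      ring
    have hγ : γ ≠ 0 := by
      rintro rfl
      simp at ha0
    have hβ : β ≠ 0 := by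
      rintro rfl
      simp [hγ, hp0] at h3
    refine ⟨γ ^ 2 / β ^ 2, ?_⟩
    apply mul_left_cancel₀ (C_ne_zero.2 (pow_ne_zero 2 hβ))
    rw [← h3, ← mul_assoc, ← C_mul]
    congr 2
    field_simp

open Polynomial in
lemma quadratic_proportional_of_mul_sq_eq {M M' A B : Matrix (Fin n) (Fin n) ℝ}
    (hM : ∀ v ≠ 0, 0 < v ⬝ᵥ M *ᵥ v) (hM' : ∀ v ≠ 0, 0 < v ⬝ᵥ M' *ᵥ v)
    (h : ∀ v, v ⬝ᵥ M *ᵥ v * (v ⬝ᵥ A *ᵥ v) ^ 2 = v ⬝ᵥ M' *ᵥ v * (v ⬝ᵥ B *ᵥ v) ^ 2)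
    {v : Fin n → ℝ} (hv : v ⬝ᵥ A *ᵥ v ≠ 0) (w : Fin n → ℝ) :
    (v ⬝ᵥ M *ᵥ v) * (w ⬝ᵥ M' *ᵥ w) = (v ⬝ᵥ M' *ᵥ v) * (w ⬝ᵥ M *ᵥ w) := by
  have hv0 : v ≠ 0 := by
    rintro rfl
    simp at hv
  by_cases hi : ∃ a : ℝ, a • v = w
  · obtain ⟨a, rfl⟩ := hi
    simp only [mulVec_smul, smul_dotProduct, dotProduct_smul, smul_eq_mul]
    ring
  push Not at hi
  have hind := LinearIndependent.pair_iff.1 ((LinearIndependent.pair_iff' hv0).2 hi)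
  have hw0 : w ≠ 0 := by
    rintro rfl
    exact hi 0 (by simp)
  have hne : ∀ s : ℝ, v + s • w ≠ 0 := by
    intro s hs
    have := (hind 1 s (by simpa using hs)).1
    norm_num at this
  set poly : Matrix (Fin n) (Fin n) ℝ → ℝ[X] := fun N =>
    C (w ⬝ᵥ N *ᵥ w) * X ^ 2 + C (v ⬝ᵥ N *ᵥ w + w ⬝ᵥ N *ᵥ v) * X + C (v ⬝ᵥ N *ᵥ v) with hpoly
  have heval : ∀ N s, (poly N).eval s = (v + s • w) ⬝ᵥ N *ᵥ (v + s • w) := by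
    intro N s
    rw [quadratic_add_smul]
    simp only [hpoly, eval_add, eval_mul, eval_C, eval_X, eval_pow]
    ring
  have hc0 : ∀ N, (poly N).coeff 0 = v ⬝ᵥ N *ᵥ v := by
    intro N
    rw [coeff_zero_eq_eval_zero, heval]
    simp
  have hc2 : ∀ N, (poly N).coeff 2 = w ⬝ᵥ N *ᵥ w := by
    intro N
    simp [hpoly]
  have hle : ∀ N, (poly N).natDegree ≤ 2 := fun N => natDegree_quadratic_le
  have hdeg : ∀ N, w ⬝ᵥ N *ᵥ w ≠ 0 → (poly N).natDegree = 2 := fun N hN =>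
    natDegree_quadratic hN
  have hA0 : poly A ≠ 0 := by
    intro h0
    apply hv
    rw [← hc0, h0, coeff_zero]
  obtain ⟨k, hk⟩ := Polynomial.exists_eq_C_mul_of_mul_sq_eq (p := poly M) (q := poly M')
    (a := poly A) (b := poly B) (hdeg _ (hM w hw0).ne') (hdeg _ (hM' w hw0).ne') (hle _) (hle _)
    (fun x hx => (hM _ (hne x)).ne' (by rw [← heval]; exact hx)) hA0
    (Polynomial.funext fun s => by simp only [eval_mul, eval_pow, heval, h])
  have h0 : v ⬝ᵥ M' *ᵥ v = k * (v ⬝ᵥ M *ᵥ v) := by rw [← hc0, hk, coeff_C_mul, hc0]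
  have h2 : w ⬝ᵥ M' *ᵥ w = k * (w ⬝ᵥ M *ᵥ w) := by rw [← hc2, hk, coeff_C_mul, hc2]
  rw [h0, h2]
  ring

lemma Matrix.PosDef.quadratic_pos {M : Matrix (Fin n) (Fin n) ℝ} (hM : M.PosDef)
    {v : Fin n → ℝ} (hv : v ≠ 0) : 0 < v ⬝ᵥ M *ᵥ v := by
  simpa using hM.dotProduct_mulVec_pos hv

lemma dotProduct_mulVec_self_of_skew {S : Matrix (Fin n) (Fin n) ℝ} (hS : Sᵀ = -S)
    (v : Fin n → ℝ) : v ⬝ᵥ S *ᵥ v = 0 := by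
  have h : v ⬝ᵥ S *ᵥ v = -(v ⬝ᵥ S *ᵥ v) := by
    conv_lhs => rw [dotProduct_mulVec, ← mulVec_transpose, hS, neg_mulVec, neg_dotProduct,
      dotProduct_comm]
  linarith

/-- Pointwise comparison of the magnetic parts of two Randers metrics with a common unparametrized
geodesic flow: if the form of the first one is nonzero, the metrics are proportional. -/
lemma exists_eq_smul_of_magnetic_parallel {M M' S S' : Matrix (Fin n) (Fin n) ℝ}
    (hM : M.PosDef) (hM' : M'.PosDef) (hMs : M.IsSymm) (hMs' : M'.IsSymm) (hS : Sᵀ = -S)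
    (hS0 : S ≠ 0)
    (h : ∀ v ≠ 0, ∃ c : ℝ, Real.sqrt (v ⬝ᵥ M' *ᵥ v) • (M'⁻¹ *ᵥ S' *ᵥ v)
      - Real.sqrt (v ⬝ᵥ M *ᵥ v) • (M⁻¹ *ᵥ S *ᵥ v) = c • v) :
    ∃ k : ℝ, 0 < k ∧ M' = k • M := by
  set A := S * (M⁻¹ * S) with hA
  set B := S * (M'⁻¹ * S') with hB
  have hAB : ∀ v, v ⬝ᵥ M *ᵥ v * (v ⬝ᵥ A *ᵥ v) ^ 2 = v ⬝ᵥ M' *ᵥ v * (v ⬝ᵥ B *ᵥ v) ^ 2 := by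
    intro v
    by_cases hv : v = 0
    · simp [hv]
    obtain ⟨c, hc⟩ := h v hv
    have h1 := congrArg (fun u => v ⬝ᵥ S *ᵥ u) hc
    simp only [mulVec_sub, mulVec_smul, dotProduct_sub, dotProduct_smul,
      dotProduct_mulVec_self_of_skew hS, smul_eq_mul, mul_zero] at h1
    have h2 : Real.sqrt (v ⬝ᵥ M *ᵥ v) * (v ⬝ᵥ A *ᵥ v)
        = Real.sqrt (v ⬝ᵥ M' *ᵥ v) * (v ⬝ᵥ B *ᵥ v) := by
      simp only [hA, hB, ← mulVec_mulVec]
      linarith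
    have h3 := congrArg (· ^ 2) h2
    simpa only [mul_pow, Real.sq_sqrt (hM.quadratic_pos hv).le,
      Real.sq_sqrt (hM'.quadratic_pos hv).le] using h3
  obtain ⟨v, hv⟩ : ∃ v, S *ᵥ v ≠ 0 := by
    by_contra! h0
    exact hS0 (Matrix.ext_of_mulVec_single fun i => by rw [h0, zero_mulVec])
  have hAv : v ⬝ᵥ A *ᵥ v ≠ 0 := by
    have h1 := hM.inv.quadratic_pos hv
    have h2 : v ⬝ᵥ A *ᵥ v = -((S *ᵥ v) ⬝ᵥ M⁻¹ *ᵥ S *ᵥ v) := by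
      rw [hA, ← mulVec_mulVec, ← mulVec_mulVec, dotProduct_mulVec, ← mulVec_transpose, hS,
        neg_mulVec, neg_dotProduct]
    rw [h2]
    exact (neg_neg_of_pos h1).ne
  have hv0 : v ≠ 0 := by
    rintro rfl
    simp at hv
  have hN := hM.quadratic_pos hv0
  have hN' := hM'.quadratic_pos hv0
  refine ⟨v ⬝ᵥ M' *ᵥ v / v ⬝ᵥ M *ᵥ v, div_pos hN' hN, ?_⟩
  rw [← sub_eq_zero]
  refine Matrix.IsSymm.eq_zero_of_quadratic_eq_zero (hMs'.sub (hMs.smul _)) fun w => ?_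
  have := quadratic_proportional_of_mul_sq_eq (fun v hv => hM.quadratic_pos hv)
    (fun v hv => hM'.quadratic_pos hv) hAB hAv w
  rw [sub_mulVec, smul_mulVec, dotProduct_sub, dotProduct_smul, smul_eq_mul]
  field_simp
  linarith

end Proportional
section Calculus

variable {n : ℕ}

/-- The matrices of first partial derivatives of a matrix field. -/
noncomputable def partials (g : (Fin n → ℝ) → Matrix (Fin n) (Fin n) ℝ) (p : Fin n → ℝ)
    (k : Fin n) : Matrix (Fin n) (Fin n) ℝ :=
  Matrix.of fun i j => dpart (fun q => g q i j) k p

lemma fderiv_eq_sum_dpart (f : (Fin n → ℝ) → ℝ) (p v : Fin n → ℝ) :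
    fderiv ℝ f p v = ∑ k, v k * dpart f k p := by
  conv_lhs => rw [pi_eq_sum_univ' v]
  simp [map_sum, dpart]

lemma hasDerivAt_comp_curve {f : (Fin n → ℝ) → ℝ} {x : ℝ → Fin n → ℝ} {t : ℝ} {v : Fin n → ℝ}
    (hf : DifferentiableAt ℝ f (x t)) (hx : HasDerivAt x v t) :
    HasDerivAt (fun s => f (x s)) (∑ k, v k * dpart f k (x t)) t := by
  rw [← fderiv_eq_sum_dpart]
  exact hf.hasFDerivAt.comp_hasDerivAt t hx

lemma hasDerivAt_matrix_comp_curve {g : (Fin n → ℝ) → Matrix (Fin n) (Fin n) ℝ}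
    {x : ℝ → Fin n → ℝ} {t : ℝ} {v : Fin n → ℝ}
    (hg : ∀ i j, DifferentiableAt ℝ (fun q => g q i j) (x t)) (hx : HasDerivAt x v t)
    (i j : Fin n) :
    HasDerivAt (fun s => g (x s) i j) (contractVec (partials g (x t)) v i j) t := by
  rw [contractVec_apply]
  exact hasDerivAt_comp_curve (hg i j) hx

lemma partials_isSymm {U : Set (Fin n → ℝ)} (hU : IsOpen U)
    {g : (Fin n → ℝ) → Matrix (Fin n) (Fin n) ℝ} (hg : ∀ p ∈ U, (g p).IsSymm)
    {p : Fin n → ℝ} (hp : p ∈ U) (k : Fin n) : (partials g p k).IsSymm := by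
  ext i j
  have h : (fun q => g q j i) =ᶠ[nhds p] fun q => g q i j := by
    filter_upwards [hU.mem_nhds hp] with q hq
    exact (hg q hq).apply i j
  simp only [partials, transpose_apply, of_apply, dpart, h.fderiv_eq]

lemma dotProduct_mulVec_eq_sum (M : Matrix (Fin n) (Fin n) ℝ) (u v : Fin n → ℝ) :
    u ⬝ᵥ M *ᵥ v = ∑ k, ∑ m, M k m * u k * v m := by
  simp only [dotProduct, mulVec, Finset.mul_sum]
  exact Finset.sum_congr rfl fun k _ => Finset.sum_congr rfl fun m _ => by ring

lemma HasDerivAt.quadratic {G : ℝ → Matrix (Fin n) (Fin n) ℝ} {G' : Matrix (Fin n) (Fin n) ℝ}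
    {y : ℝ → Fin n → ℝ} {t : ℝ} {a : Fin n → ℝ}
    (hG : ∀ i j, HasDerivAt (fun s => G s i j) (G' i j) t)
    (hs : (G t).IsSymm) (hy : HasDerivAt y a t) :
    HasDerivAt (fun s => y s ⬝ᵥ G s *ᵥ y s) (y t ⬝ᵥ G' *ᵥ y t + 2 * (y t ⬝ᵥ G t *ᵥ a)) t := by
  have hyi := hasDerivAt_pi.1 hy
  have h1 : HasDerivAt (fun s => ∑ k, ∑ m, G s k m * y s k * y s m)
      (∑ k, ∑ m, ((G' k m * y t k + G t k m * a k) * y t m + G t k m * y t k * a m)) t :=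
    HasDerivAt.fun_sum fun k _ => HasDerivAt.fun_sum fun m _ =>
      ((hG k m).mul (hyi k)).mul (hyi m)
  simp only [dotProduct_mulVec_eq_sum]
  convert h1 using 1
  have h2 : ∑ k, ∑ m, G t k m * a k * y t m = ∑ k, ∑ m, G t k m * y t k * a m := by
    rw [Finset.sum_comm]
    refine Finset.sum_congr rfl fun k _ => Finset.sum_congr rfl fun m _ => ?_
    rw [hs.apply k m]
    ring
  simp only [add_mul, Finset.sum_add_distrib, h2]
  ring

lemma contDiff_det_of (k : WithTop ℕ∞) :
    ContDiff ℝ k fun m : Fin n → Fin n → ℝ => (Matrix.of m).det := by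
  simp only [det_apply, of_apply, Units.smul_def, zsmul_eq_mul]
  fun_prop

lemma HasDerivAt.log_det {G : ℝ → Matrix (Fin n) (Fin n) ℝ} {G' : Matrix (Fin n) (Fin n) ℝ}
    {t : ℝ} (hG : ∀ i j, HasDerivAt (fun s => G s i j) (G' i j) t) (hpos : 0 < (G t).det) :
    HasDerivAt (fun s => Real.log (G s).det) ((G t)⁻¹ * G').trace t := by
  set δ : (Fin n → Fin n → ℝ) → ℝ := fun m => (Matrix.of m).det with hδ
  have hd : DifferentiableAt ℝ δ (fun i j => G t i j) :=
    ((contDiff_det_of 1).differentiable one_ne_zero) _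
  have hG1 : HasDerivAt (fun s => fun i j => G s i j) (fun i j => G' i j) t :=
    hasDerivAt_pi.2 fun i => hasDerivAt_pi.2 fun j => hG i j
  have hG2 : HasDerivAt (fun s : ℝ => fun i j => G t i j + s * G' i j) (fun i j => G' i j) 0 :=
    hasDerivAt_pi.2 fun i => hasDerivAt_pi.2 fun j => by
      simpa using ((hasDerivAt_id (0 : ℝ)).mul_const (G' i j)).const_add (G t i j)
  have h1 : HasDerivAt (fun s => (G s).det) (fderiv ℝ δ (fun i j => G t i j) fun i j => G' i j) t :=
    hd.hasFDerivAt.comp_hasDerivAt t hG1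
  have h2 : HasDerivAt (fun s : ℝ => δ fun i j => G t i j + s * G' i j)
      (fderiv ℝ δ (fun i j => G t i j) fun i j => G' i j) 0 := by
    have h0 : (fun i j => G t i j + (0 : ℝ) * G' i j) = fun i j => G t i j := by simp
    refine HasFDerivAt.comp_hasDerivAt (0 : ℝ) ?_ hG2
    rw [h0]
    exact hd.hasFDerivAt
  set Q : Polynomial ℝ :=
    (det (1 + (Polynomial.X : Polynomial ℝ) • ((G t)⁻¹ * G').map Polynomial.C)).divX.divX
  have h3 : (fun s : ℝ => δ fun i j => G t i j + s * G' i j)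
      = fun s => (G t).det * (1 + ((G t)⁻¹ * G').trace * s + Q.eval s * s ^ 2) := by
    funext s
    rw [← det_one_add_smul, ← det_mul, mul_add, mul_one, Matrix.mul_smul, ← mul_assoc,
      mul_nonsing_inv _ (isUnit_iff_ne_zero.2 hpos.ne'), one_mul]
    rfl
  have h4 : HasDerivAt (fun s => (G t).det * (1 + ((G t)⁻¹ * G').trace * s + Q.eval s * s ^ 2))
      ((G t).det * ((G t)⁻¹ * G').trace) 0 := by
    have h5 := (((hasDerivAt_id (0 : ℝ)).const_mul ((G t)⁻¹ * G').trace).const_add 1).add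
      ((Q.hasDerivAt 0).mul ((hasDerivAt_id (0 : ℝ)).pow 2))
    simpa using h5.const_mul (G t).det
  rw [h3] at h2
  have h6 := h1.log hpos.ne'
  rwa [h2.unique h4, mul_div_cancel_left₀ _ hpos.ne'] at h6

/-- Painlevé's first integral: if two metrics have the same unparametrized geodesics, then
`(n + 1) log (g'(v, v) / g(v, v)) - 2 log (det g' / det g)` is constant along the affinely
parametrized geodesics of `g`. -/
lemma hasDerivAt_painleve {U : Set (Fin n → ℝ)} (hU : IsOpen U)
    {g g' : (Fin n → ℝ) → Matrix (Fin n) (Fin n) ℝ}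
    (hgs : ∀ p ∈ U, (g p).IsSymm) (hgs' : ∀ p ∈ U, (g' p).IsSymm)
    (hgp : ∀ p ∈ U, (g p).PosDef) (hgp' : ∀ p ∈ U, (g' p).PosDef)
    (hgd : ∀ p ∈ U, ∀ i j, DifferentiableAt ℝ (fun q => g q i j) p)
    (hgd' : ∀ p ∈ U, ∀ i j, DifferentiableAt ℝ (fun q => g' q i j) p)
    (hproj : ∀ p ∈ U, ∀ v ≠ 0, ∃ c : ℝ,
      spray (g' p) (partials g' p) v - spray (g p) (partials g p) v = c • v)
    {x y : ℝ → Fin n → ℝ} {t : ℝ} (hxU : x t ∈ U) (hy0 : y t ≠ 0) (hx : HasDerivAt x (y t) t)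
    (hy : HasDerivAt y (-spray (g (x t)) (partials g (x t)) (y t)) t) :
    HasDerivAt (fun s => (n + 1) * (Real.log (y s ⬝ᵥ g' (x s) *ᵥ y s)
        - Real.log (y s ⬝ᵥ g (x s) *ᵥ y s))
      - 2 * (Real.log (g' (x s)).det - Real.log (g (x s)).det)) 0 t := by
  set p := x t with hp
  set v := y t with hv
  set M := g p
  set M' := g' p
  set D := partials g p
  set D' := partials g' p
  have hM : IsUnit M.det := isUnit_iff_ne_zero.2 (hgp p hxU).det_pos.ne'
  have hM' : IsUnit M'.det := isUnit_iff_ne_zero.2 (hgp' p hxU).det_pos.ne'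
  obtain ⟨l, hl⟩ := exists_linear_factor (fun v => spray M' D' v - spray M D v)
    (fun a v => by simp only [spray_smul, smul_sub])
    (fun u v => by
      have h1 := spray_parallelogram M' D' u v
      have h2 := spray_parallelogram M D u v
      simp only [smul_sub]
      rw [sub_add_sub_comm, h1, h2]
      abel)
    (hproj p hxU)
  have htr : (M'⁻¹ * contractVec D' v).trace - (M⁻¹ * contractVec D v).trace = (n + 1) * l v := by
    rw [← sum_polar_of_linear_factor l hl, ← sum_polar_spray (hgs p hxU)
      (fun k => partials_isSymm hU hgs hxU k), ← sum_polar_spray (hgs' p hxU)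
      (fun k => partials_isSymm hU hgs' hxU k), ← Finset.sum_sub_distrib]
    refine Finset.sum_congr rfl fun j _ => ?_
    simp only [Pi.sub_apply]
    ring
  have hG := hasDerivAt_matrix_comp_curve (hgd p hxU) hx
  have hG' := hasDerivAt_matrix_comp_curve (hgd' p hxU) hx
  have hN := HasDerivAt.quadratic hG (hgs p hxU) hy
  have hN' := HasDerivAt.quadratic hG' (hgs' p hxU) hy
  have hNp : 0 < v ⬝ᵥ M *ᵥ v := (hgp p hxU).quadratic_pos hy0
  have hNp' : 0 < v ⬝ᵥ M' *ᵥ v := (hgp' p hxU).quadratic_pos hy0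
  have e1 : v ⬝ᵥ contractVec D v *ᵥ v + 2 * (v ⬝ᵥ M *ᵥ (-spray M D v)) = 0 := by
    rw [← two_mul_dotProduct_spray hM, mulVec_neg, dotProduct_neg]
    ring
  have e2 : v ⬝ᵥ contractVec D' v *ᵥ v + 2 * (v ⬝ᵥ M' *ᵥ (-spray M D v))
      = 2 * l v * (v ⬝ᵥ M' *ᵥ v) := by
    have h3 : spray M D v = spray M' D' v - l v • v := by
      rw [← hl]
      abel
    rw [← two_mul_dotProduct_spray hM', h3, mulVec_neg, mulVec_sub, dotProduct_neg,
      dotProduct_sub, mulVec_smul, dotProduct_smul, smul_eq_mul]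
    ring
  have hfin := (((hN'.log hNp'.ne').sub (hN.log hNp.ne')).const_mul ((n : ℝ) + 1)).sub
    (((HasDerivAt.log_det hG' (hgp' p hxU).det_pos).sub
      (HasDerivAt.log_det hG (hgp p hxU).det_pos)).const_mul 2)
  refine hfin.congr_deriv ?_
  change (n + 1) * ((v ⬝ᵥ contractVec D' v *ᵥ v + 2 * (v ⬝ᵥ M' *ᵥ (-spray M D v)))
      / (v ⬝ᵥ M' *ᵥ v) - (v ⬝ᵥ contractVec D v *ᵥ v + 2 * (v ⬝ᵥ M *ᵥ (-spray M D v)))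
      / (v ⬝ᵥ M *ᵥ v)) - 2 * ((M'⁻¹ * contractVec D' v).trace - (M⁻¹ * contractVec D v).trace) = 0
  rw [htr, e1, e2, mul_div_cancel_right₀ _ hNp'.ne']
  ring

end Calculus
section LocalFlow

open Set

/-- A `C¹` vector field has, near any point, a local flow staying in a prescribed neighbourhood
and continuous in the initial condition. -/
lemma exists_local_flow {E : Type*} [NormedAddCommGroup E] [NormedSpace ℝ E] [CompleteSpace E]
    {f : E → E} {z₀ : E} {W : Set E} (hW : W ∈ nhds z₀) (hf : ContDiffAt ℝ 1 f z₀) :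
    ∃ ε > (0 : ℝ), ∃ S ∈ nhds z₀, ∃ α : E → ℝ → E, (∀ z ∈ S, α z 0 = z) ∧
      (∀ z ∈ S, ∀ t ∈ Ioo (-ε) ε, HasDerivAt (α z) (f (α z t)) t ∧ α z t ∈ W) ∧
      ∀ t ∈ Ioo (-ε) ε, ContinuousAt (fun z => α z t) z₀ := by
  obtain ⟨ε, hε, a, r, L, K, hr, hpl⟩ := IsPicardLindelof.of_contDiffAt_one hf
  obtain ⟨α, hα, hc⟩ :=
    (hpl 0).exists_forall_mem_closedBall_eq_hasDerivWithinAt_continuousOn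
  simp only [zero_sub, zero_add] at hα hc
  have hr' : (0 : ℝ) < r := hr
  have hat : ∀ t ∈ Ioo (-ε) ε, ContinuousAt α (z₀, t) := fun t ht =>
    hc.continuousAt (prod_mem_nhds (Metric.closedBall_mem_nhds z₀ hr') (Icc_mem_nhds ht.1 ht.2))
  have h0 : α (z₀, 0) = z₀ := (hα z₀ (Metric.mem_closedBall_self hr'.le)).1
  have hpre : α ⁻¹' W ∈ nhds (z₀, (0 : ℝ)) :=
    (hat 0 (by simp [hε])).preimage_mem_nhds (by rwa [h0])
  obtain ⟨S, hS, T, hT, hST⟩ := mem_nhds_prod_iff.1 hpre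
  obtain ⟨δ, hδ, hδT⟩ := Metric.mem_nhds_iff.1 hT
  have hsub : ∀ t ∈ Ioo (-min ε δ) (min ε δ), t ∈ Ioo (-ε) ε ∧ t ∈ T := by
    intro t ht
    have ht' := abs_lt.2 ht
    refine ⟨abs_lt.1 (ht'.trans_le (min_le_left _ _)), hδT ?_⟩
    simpa using ht'.trans_le (min_le_right _ _)
  refine ⟨min ε δ, lt_min hε hδ, S ∩ Metric.closedBall z₀ r,
    Filter.inter_mem hS (Metric.closedBall_mem_nhds z₀ hr'), fun z t => α (z, t),
    fun z hz => (hα z hz.2).1, fun z hz t ht => ⟨?_, hST ⟨hz.1, (hsub t ht).2⟩⟩, fun t ht => ?_⟩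
  · have ht' := (hsub t ht).1
    exact ((hα z hz.2).2 t (Ioo_subset_Icc_self ht')).hasDerivAt (Icc_mem_nhds ht'.1 ht'.2)
  · exact (hat t (hsub t ht).1).comp (f := fun z => (z, t))
      (continuous_id.prodMk continuous_const).continuousAt

end LocalFlow

section Regularity

variable {n : ℕ} {F : Type*} [NormedAddCommGroup F] [NormedSpace ℝ F]

lemma ContDiffOn.matrix_det {k : WithTop ℕ∞} {s : Set F} {G : F → Matrix (Fin n) (Fin n) ℝ}
    (hG : ∀ i j, ContDiffOn ℝ k (fun q => G q i j) s) : ContDiffOn ℝ k (fun q => (G q).det) s :=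
  (contDiff_det_of k).comp_contDiffOn (contDiffOn_pi.2 fun i => contDiffOn_pi.2 fun j => hG i j)

lemma ContDiffOn.matrix_inv {k : WithTop ℕ∞} {s : Set F} {G : F → Matrix (Fin n) (Fin n) ℝ}
    (hG : ∀ i j, ContDiffOn ℝ k (fun q => G q i j) s) (hdet : ∀ q ∈ s, (G q).det ≠ 0)
    (i j : Fin n) : ContDiffOn ℝ k (fun q => (G q)⁻¹ i j) s := by
  have h : (fun q => (G q)⁻¹ i j)
      = fun q => (G q).det⁻¹ * ((G q).updateRow j (Pi.single i 1)).det := by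
    funext q
    rw [inv_def, Matrix.smul_apply, Ring.inverse_eq_inv', adjugate_apply, smul_eq_mul]
  rw [h]
  refine ((ContDiffOn.matrix_det hG).inv hdet).mul (ContDiffOn.matrix_det fun a b => ?_)
  by_cases ha : a = j
  · simpa [updateRow_apply, ha] using contDiffOn_const
  · simpa [updateRow_apply, ha] using hG a b

lemma ContDiffOn.matrix_mulVec {k : WithTop ℕ∞} {s : Set F} {G : F → Matrix (Fin n) (Fin n) ℝ}
    {v : F → Fin n → ℝ} (hG : ∀ i j, ContDiffOn ℝ k (fun q => G q i j) s)
    (hv : ContDiffOn ℝ k v s) : ContDiffOn ℝ k (fun q => G q *ᵥ v q) s :=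
  by
  refine contDiffOn_pi.2 fun i => ?_
  simp only [mulVec, _root_.dotProduct]
  exact ContDiffOn.sum fun j _ => (hG i j).mul (contDiffOn_pi.1 hv j)

lemma ContDiffOn.dotProduct {k : WithTop ℕ∞} {s : Set F} {u v : F → Fin n → ℝ}
    (hu : ContDiffOn ℝ k u s) (hv : ContDiffOn ℝ k v s) :
    ContDiffOn ℝ k (fun q => u q ⬝ᵥ v q) s :=
  ContDiffOn.sum fun j _ => (contDiffOn_pi.1 hu j).mul (contDiffOn_pi.1 hv j)

lemma ContDiffOn.dpart {U : Set (Fin n → ℝ)} (hU : IsOpen U) {f : (Fin n → ℝ) → ℝ}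
    {m k : WithTop ℕ∞} (hmk : m + 1 ≤ k) (hf : ContDiffOn ℝ k f U) (i : Fin n) :
    ContDiffOn ℝ m (fun q => _root_.dpart f i q) U :=
  (hf.fderiv_of_isOpen hU hmk).clm_apply contDiffOn_const

/-- The acceleration of the geodesics of `(g, ω)` parametrized with constant `g`-speed. -/
noncomputable def randersAcc (g : (Fin n → ℝ) → Matrix (Fin n) (Fin n) ℝ)
    (ω : (Fin n → ℝ) → Fin n → ℝ) (p v : Fin n → ℝ) : Fin n → ℝ :=
  -spray (g p) (partials g p) v - √(v ⬝ᵥ g p *ᵥ v) • ((g p)⁻¹ *ᵥ dform ω p *ᵥ v)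

/-- The phase space of nonzero vectors over `U`. -/
def phaseSpace (U : Set (Fin n → ℝ)) : Set ((Fin n → ℝ) × (Fin n → ℝ)) := U ×ˢ {v | v ≠ 0}

lemma isOpen_phaseSpace {U : Set (Fin n → ℝ)} (hU : IsOpen U) : IsOpen (phaseSpace U) :=
  hU.prod isOpen_ne

lemma contDiffOn_randersAcc {U : Set (Fin n → ℝ)} (hU : IsOpen U)
    {g : (Fin n → ℝ) → Matrix (Fin n) (Fin n) ℝ} {ω : (Fin n → ℝ) → Fin n → ℝ}
    (h : IsRandersDatum U g ω) :
    ContDiffOn ℝ 1 (fun z : (Fin n → ℝ) × (Fin n → ℝ) => (z.2, randersAcc g ω z.1 z.2))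
      (phaseSpace U) := by
  have h1 : Set.MapsTo Prod.fst (phaseSpace U) U := fun z hz => hz.1
  have hfst : ContDiffOn ℝ 1 (Prod.fst : (Fin n → ℝ) × (Fin n → ℝ) → _) (phaseSpace U) :=
    contDiffOn_fst
  have hsnd : ContDiffOn ℝ 1 (Prod.snd : (Fin n → ℝ) × (Fin n → ℝ) → _) (phaseSpace U) :=
    contDiffOn_snd
  have hg : ∀ i j, ContDiffOn ℝ 1 (fun z : (Fin n → ℝ) × (Fin n → ℝ) => g z.1 i j)
      (phaseSpace U) := fun i j => ((h.2.1 i j).of_le one_le_two).comp hfst h1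
  have hgi := ContDiffOn.matrix_inv hg fun z hz => (h.1 z.1 hz.1).2.det_pos.ne'
  have hdg : ∀ k i j, ContDiffOn ℝ 1
      (fun z : (Fin n → ℝ) × (Fin n → ℝ) => partials g z.1 k i j) (phaseSpace U) :=
    fun k i j => (ContDiffOn.dpart hU (by norm_num [one_add_one_eq_two]) (h.2.1 i j) k).comp hfst h1
  have hdω : ∀ i j, ContDiffOn ℝ 1
      (fun z : (Fin n → ℝ) × (Fin n → ℝ) => dform ω z.1 i j) (phaseSpace U) :=
    fun i j => ((ContDiffOn.dpart hU (by norm_num [one_add_one_eq_two]) (h.2.2 i) j).sub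
      (ContDiffOn.dpart hU (by norm_num [one_add_one_eq_two]) (h.2.2 j) i)).comp hfst h1
  have hcv : ∀ i j, ContDiffOn ℝ 1 (fun z : (Fin n → ℝ) × (Fin n → ℝ) =>
      contractVec (partials g z.1) z.2 i j) (phaseSpace U) := by
    intro i j
    simp only [contractVec_apply]
    exact ContDiffOn.sum fun k _ => (contDiffOn_pi.1 hsnd k).mul (hdg k i j)
  have hlow : ContDiffOn ℝ 1 (fun z : (Fin n → ℝ) × (Fin n → ℝ) =>
      lowerSpray (partials g z.1) z.2) (phaseSpace U) := by
    have h2 : ContDiffOn ℝ 1 (fun z : (Fin n → ℝ) × (Fin n → ℝ) =>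
        fun i => z.2 ⬝ᵥ partials g z.1 i *ᵥ z.2) (phaseSpace U) :=
      contDiffOn_pi.2 fun i => hsnd.dotProduct (ContDiffOn.matrix_mulVec (hdg i) hsnd)
    exact (ContDiffOn.matrix_mulVec hcv hsnd).sub (h2.const_smul (1 / 2 : ℝ))
  have hsq := (hsnd.dotProduct (ContDiffOn.matrix_mulVec hg hsnd)).sqrt fun z hz =>
    ((h.1 z.1 hz.1).2.quadratic_pos hz.2).ne'
  exact hsnd.prodMk (((ContDiffOn.matrix_mulVec hgi hlow).neg).sub (hsq.smul
    (ContDiffOn.matrix_mulVec hgi (ContDiffOn.matrix_mulVec hdω hsnd))))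

end Regularity
section Geodesics

open Set

variable {n : ℕ} {U : Set (Fin n → ℝ)} {g : (Fin n → ℝ) → Matrix (Fin n) (Fin n) ℝ}
  {ω : (Fin n → ℝ) → Fin n → ℝ}

lemma euler_lagrange_eq (g : (Fin n → ℝ) → Matrix (Fin n) (Fin n) ℝ)
    (ω : (Fin n → ℝ) → Fin n → ℝ) (p v a : Fin n → ℝ) (s d : ℝ) (j : Fin n) :
    a j / s + v j * d
      + (1 / s) * ∑ i, ∑ k, ∑ m, (g p)⁻¹ j i * dpart (fun q => g q i m) k p * v k * v m
      + ∑ i, ∑ k, (g p)⁻¹ j i * (dpart (fun q => ω q i) k p - dpart (fun q => ω q k) i p) * v k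
      - (1 / (2 * s)) * ∑ i, ∑ k, ∑ m, (g p)⁻¹ j i * dpart (fun r => g r k m) i p * v k * v m
    = a j / s + v j * d + (1 / s) * spray (g p) (partials g p) v j
      + ((g p)⁻¹ *ᵥ dform ω p *ᵥ v) j := by
  have h1 : ∑ i, ∑ k, ∑ m, (g p)⁻¹ j i * dpart (fun q => g q i m) k p * v k * v m
      = ((g p)⁻¹ *ᵥ contractVec (partials g p) v *ᵥ v) j := by
    simp only [mulVec, dotProduct, contractVec_apply, partials, of_apply, Finset.mul_sum,
      Finset.sum_mul]
    refine Finset.sum_congr rfl fun i _ => ?_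
    rw [Finset.sum_comm]
    exact Finset.sum_congr rfl fun k _ => Finset.sum_congr rfl fun m _ => by ring
  have h2 : ∑ i, ∑ k, (g p)⁻¹ j i * (dpart (fun q => ω q i) k p - dpart (fun q => ω q k) i p) * v k
      = ((g p)⁻¹ *ᵥ dform ω p *ᵥ v) j := by
    simp only [mulVec, dotProduct, dform, of_apply, Finset.mul_sum]
    exact Finset.sum_congr rfl fun i _ => Finset.sum_congr rfl fun k _ => by ring
  have h3 : ∑ i, ∑ k, ∑ m, (g p)⁻¹ j i * dpart (fun r => g r k m) i p * v k * v m
      = ((g p)⁻¹ *ᵥ fun i => v ⬝ᵥ partials g p i *ᵥ v) j := by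
    simp only [mulVec, dotProduct, partials, of_apply, Finset.mul_sum]
    exact Finset.sum_congr rfl fun i _ => Finset.sum_congr rfl fun k _ =>
      Finset.sum_congr rfl fun m _ => by ring
  rw [h1, h2, h3, spray, lowerSpray, mulVec_sub, mulVec_smul]
  simp only [Pi.sub_apply, Pi.smul_apply, smul_eq_mul]
  ring

lemma transpose_dform (ω : (Fin n → ℝ) → Fin n → ℝ) (p : Fin n → ℝ) :
    (dform ω p)ᵀ = -dform ω p := by
  ext i j
  simp [dform]

lemma differentiableAt_of_isRandersDatum (hU : IsOpen U) (h : IsRandersDatum U g ω)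
    {p : Fin n → ℝ} (hp : p ∈ U) (i j : Fin n) : DifferentiableAt ℝ (fun q => g q i j) p :=
  ((h.2.1 i j).differentiableOn two_ne_zero).differentiableAt (hU.mem_nhds hp)

lemma hasDerivAt_energy (hU : IsOpen U) (h : IsRandersDatum U g ω) {x y : ℝ → Fin n → ℝ} {t : ℝ}
    (hxU : x t ∈ U) (hx : HasDerivAt x (y t) t)
    (hy : HasDerivAt y (randersAcc g ω (x t) (y t)) t) :
    HasDerivAt (fun s => y s ⬝ᵥ g (x s) *ᵥ y s) 0 t := by
  have hM : IsUnit (g (x t)).det := isUnit_iff_ne_zero.2 (h.1 _ hxU).2.det_pos.ne'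
  refine (HasDerivAt.quadratic (hasDerivAt_matrix_comp_curve
    (fun i j => differentiableAt_of_isRandersDatum hU h hxU i j) hx) (h.1 _ hxU).1
    hy).congr_deriv ?_
  rw [randersAcc, mulVec_sub, mulVec_neg, mulVec_smul, mulVec_mulVec _ (g (x t)) (g (x t))⁻¹,
    mul_nonsing_inv _ hM, one_mulVec, dotProduct_sub, dotProduct_neg, dotProduct_smul,
    dotProduct_mulVec_self_of_skew (transpose_dform ω (x t)), ← two_mul_dotProduct_spray hM]
  simp

lemma exists_isRandersGeodesic (hU : IsOpen U) (h : IsRandersDatum U g ω) {p v : Fin n → ℝ}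
    (hp : p ∈ U) (hv : v ≠ 0) :
    ∃ ε > 0, ∃ x : ℝ → Fin n → ℝ, IsRandersGeodesic U g ω (Ioo (-ε) ε) x ∧ x 0 = p ∧
      deriv x 0 = v ∧ deriv (deriv x) 0 = randersAcc g ω p v := by
  have hW : phaseSpace U ∈ nhds (p, v) := (isOpen_phaseSpace hU).mem_nhds ⟨hp, hv⟩
  obtain ⟨ε, hε, S, hS, α, h0, hα, -⟩ :=
    exists_local_flow hW ((contDiffOn_randersAcc hU h).contDiffAt hW)
  have hz0 := h0 _ (mem_of_mem_nhds hS)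
  have hz := hα _ (mem_of_mem_nhds hS)
  set x : ℝ → Fin n → ℝ := fun t => (α (p, v) t).1 with hxdef
  set y : ℝ → Fin n → ℝ := fun t => (α (p, v) t).2 with hydef
  have hx : ∀ t ∈ Ioo (-ε) ε, HasDerivAt x (y t) t := fun t ht =>
    (ContinuousLinearMap.fst ℝ (Fin n → ℝ) (Fin n → ℝ)).hasFDerivAt.comp_hasDerivAt t (hz t ht).1
  have hy : ∀ t ∈ Ioo (-ε) ε, HasDerivAt y (randersAcc g ω (x t) (y t)) t := fun t ht =>
    (ContinuousLinearMap.snd ℝ (Fin n → ℝ) (Fin n → ℝ)).hasFDerivAt.comp_hasDerivAt t (hz t ht).1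
  have hU' : ∀ t ∈ Ioo (-ε) ε, x t ∈ U := fun t ht => (hz t ht).2.1
  have hdx : ∀ t ∈ Ioo (-ε) ε, deriv x t = y t := fun t ht => (hx t ht).deriv
  have hdxe : ∀ t ∈ Ioo (-ε) ε, deriv x =ᶠ[nhds t] y := fun t ht => by
    filter_upwards [isOpen_Ioo.mem_nhds ht] with s hs using hdx s hs
  have hddx : ∀ t ∈ Ioo (-ε) ε, deriv (deriv x) t = randersAcc g ω (x t) (y t) := fun t ht => by
    rw [(hdxe t ht).deriv_eq, (hy t ht).deriv]
  have h0mem : (0 : ℝ) ∈ Ioo (-ε) ε := by simp [hε]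
  have hx0 : x 0 = p := by simp [hxdef, hz0]
  have hy0 : y 0 = v := by simp [hydef, hz0]
  refine ⟨ε, hε, x, ⟨isOpen_Ioo, ordConnected_Ioo, hU', ?_, fun t ht => ?_, fun t ht j => ?_⟩, hx0,
    by rw [hdx 0 h0mem, hy0], by rw [hddx 0 h0mem, hx0, hy0]⟩
  · have hzc : ContinuousOn (α (p, v)) (Ioo (-ε) ε) := fun t ht =>
      (hz t ht).1.continuousAt.continuousWithinAt
    have hac : ContinuousOn (fun t => randersAcc g ω (x t) (y t)) (Ioo (-ε) ε) :=
      continuous_snd.comp_continuousOn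
        ((contDiffOn_randersAcc hU h).continuousOn.comp hzc fun t ht => (hz t ht).2)
    have hy1 : ContDiffOn ℝ (0 + 1) y (Ioo (-ε) ε) := by
      rw [contDiffOn_succ_iff_deriv_of_isOpen isOpen_Ioo]
      refine ⟨fun t ht => (hy t ht).differentiableAt.differentiableWithinAt, by simp, ?_⟩
      exact contDiffOn_zero.2 (hac.congr fun t ht => (hy t ht).deriv)
    have hx2 : ContDiffOn ℝ (1 + 1) x (Ioo (-ε) ε) := by
      rw [contDiffOn_succ_iff_deriv_of_isOpen isOpen_Ioo]
      refine ⟨fun t ht => (hx t ht).differentiableAt.differentiableWithinAt, by simp, ?_⟩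
      rw [zero_add] at hy1
      exact hy1.congr hdx
    rwa [one_add_one_eq_two] at hx2
  · rw [hdx t ht]
    exact (hz t ht).2.2
  · simp only [← dotProduct_mulVec_eq_sum]
    rw [euler_lagrange_eq g ω (x t) (deriv x t) (deriv (deriv x) t), hddx t ht, hdx t ht]
    have hN : 0 < y t ⬝ᵥ g (x t) *ᵥ y t := (h.1 _ (hU' t ht)).2.quadratic_pos (hz t ht).2.2
    have hd : deriv (fun s => 1 / √(deriv x s ⬝ᵥ g (x s) *ᵥ deriv x s)) t = 0 := by
      have he : (fun s => 1 / √(deriv x s ⬝ᵥ g (x s) *ᵥ deriv x s))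
          =ᶠ[nhds t] fun s => (√(y s ⬝ᵥ g (x s) *ᵥ y s))⁻¹ := by
        filter_upwards [hdxe t ht] with s hs
        rw [hs, one_div]
      rw [he.deriv_eq]
      have := ((hasDerivAt_energy hU h (hU' t ht) (hx t ht) (hy t ht)).sqrt hN.ne').fun_inv
        (Real.sqrt_pos.2 hN).ne'
      simpa using this.deriv
    rw [hd, randersAcc]
    have hs := (Real.sqrt_pos.2 hN).ne'
    simp only [Pi.sub_apply, Pi.neg_apply, Pi.smul_apply, smul_eq_mul]
    field_simp
    ring

/-- The pointwise form of projective relatedness of two Randers data, split into its even and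
odd parts in the velocity. -/
lemma spray_and_magnetic_parallel (hU : IsOpen U) (h : IsRandersDatum U g ω)
    {g' : (Fin n → ℝ) → Matrix (Fin n) (Fin n) ℝ} {ω' : (Fin n → ℝ) → Fin n → ℝ}
    (hg' : ∀ p ∈ U, (g' p).PosDef)
    (hproj : ∀ (I : Set ℝ) (x : ℝ → (Fin n → ℝ)),
      IsRandersGeodesic U g ω I x → IsRandersGeodesic U g' ω' I x)
    {p : Fin n → ℝ} (hp : p ∈ U) :
    (∀ v ≠ 0, ∃ c : ℝ, spray (g' p) (partials g' p) v - spray (g p) (partials g p) v = c • v) ∧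
    ∀ v ≠ 0, ∃ c : ℝ, √(v ⬝ᵥ g' p *ᵥ v) • ((g' p)⁻¹ *ᵥ dform ω' p *ᵥ v)
      - √(v ⬝ᵥ g p *ᵥ v) • ((g p)⁻¹ *ᵥ dform ω p *ᵥ v) = c • v := by
  have key : ∀ v ≠ 0, ∃ c : ℝ,
      spray (g' p) (partials g' p) v - spray (g p) (partials g p) v
        + (√(v ⬝ᵥ g' p *ᵥ v) • ((g' p)⁻¹ *ᵥ dform ω' p *ᵥ v)
          - √(v ⬝ᵥ g p *ᵥ v) • ((g p)⁻¹ *ᵥ dform ω p *ᵥ v)) = c • v := by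
    intro v hv
    obtain ⟨ε, hε, x, hx, hx0, hdx, hddx⟩ := exists_isRandersGeodesic hU h hp hv
    have hEL := (hproj _ x hx).2.2.2.2.2 0 (by simp [hε])
    simp only [← dotProduct_mulVec_eq_sum] at hEL
    set d := deriv (fun s => 1 / √(deriv x s ⬝ᵥ g' (x s) *ᵥ deriv x s)) 0
    refine ⟨-(√(v ⬝ᵥ g' p *ᵥ v) * d), ?_⟩
    have hs := (Real.sqrt_pos.2 ((hg' p hp).quadratic_pos hv)).ne'
    ext j
    have hj := hEL j
    rw [euler_lagrange_eq g' ω' (x 0) (deriv x 0) (deriv (deriv x) 0), hddx, hdx, hx0,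
      randersAcc] at hj
    simp only [Pi.add_apply, Pi.sub_apply, Pi.neg_apply, Pi.smul_apply, smul_eq_mul] at hj ⊢
    field_simp at hj
    linear_combination hj
  have hneg : ∀ (M : Matrix (Fin n) (Fin n) ℝ) D v, spray M D (-v) = spray M D v := by
    intro M D v
    simpa using spray_smul M D (-1) v
  refine ⟨fun v hv => ?_, fun v hv => ?_⟩
  all_goals
    obtain ⟨c, hc⟩ := key v hv
    obtain ⟨d, hd⟩ := key (-v) (neg_ne_zero.2 hv)
    simp only [hneg, mulVec_neg, dotProduct_neg, neg_dotProduct, neg_neg, smul_neg] at hd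
  · refine ⟨(c - d) / 2, ?_⟩
    ext j
    have h1 := congrFun hc j
    have h2 := congrFun hd j
    simp only [Pi.add_apply, Pi.sub_apply, Pi.neg_apply, Pi.smul_apply, smul_eq_mul] at h1 h2 ⊢
    linear_combination (h1 + h2) / 2
  · refine ⟨(c + d) / 2, ?_⟩
    ext j
    have h1 := congrFun hc j
    have h2 := congrFun hd j
    simp only [Pi.add_apply, Pi.sub_apply, Pi.neg_apply, Pi.smul_apply, smul_eq_mul] at h1 h2 ⊢
    linear_combination (h1 - h2) / 2

end Geodesics
section Propagation

open Set

/-- An open set that contains every point of `U` at which it is touched by one of its balls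
contains all of a connected set `U` which it meets. -/
lemma subset_of_touching_balls {E : Type*} [NormedAddCommGroup E] [ProperSpace E] {U O : Set E}
    (hU : IsOpen U) (hUc : IsPreconnected U) (hO : IsOpen O) (hne : (U ∩ O).Nonempty)
    (h : ∀ p ∈ U, ∀ q, p ≠ q → Metric.ball q (dist p q) ⊆ O → p ∈ O) : U ⊆ O := by
  refine hUc.subset_of_closure_inter_subset hO hne ?_
  rintro b ⟨hbO, hbU⟩
  by_contra hb
  obtain ⟨δ, hδ, hδU⟩ := Metric.isOpen_iff.1 hU b hbU
  obtain ⟨q, hqO, hq⟩ := Metric.mem_closure_iff.1 hbO (δ / 2) (half_pos hδ)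
  obtain ⟨p, hpO, hp⟩ := hO.isClosed_compl.exists_infDist_eq_dist ⟨b, hb⟩ q
  have hpb : Metric.infDist q Oᶜ ≤ dist q b := Metric.infDist_le_dist_of_mem hb
  have hpU : p ∈ U := by
    refine hδU ?_
    have h1 := dist_triangle p q b
    rw [dist_comm p q, ← hp] at h1
    rw [dist_comm] at hq
    rw [Metric.mem_ball]
    linarith
  refine hpO (h p hpU q (fun hpq => hpO (hpq ▸ hqO)) fun z hz => ?_)
  by_contra hzO
  have h2 : Metric.infDist q Oᶜ ≤ dist q z := Metric.infDist_le_dist_of_mem hzO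
  rw [Metric.mem_ball, dist_comm z q, dist_comm p q] at hz
  linarith

/-- A curve leaving a boundary point of a ball towards the centre enters the ball. -/
lemma exists_pos_mem_ball {E : Type*} [NormedAddCommGroup E] [NormedSpace ℝ E] {x : ℝ → E}
    {p q : E} (hpq : p ≠ q) (hx0 : x 0 = p) (hx : HasDerivAt x (q - p) 0) {ε : ℝ} (hε : 0 < ε) :
    ∃ t ∈ Ioo 0 ε, x t ∈ Metric.ball q (dist p q) := by
  have hr : 0 < dist p q := dist_pos.2 hpq
  have h1 := (hasDerivAt_iff_isLittleO.1 hx).def (half_pos hr)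
  obtain ⟨δ, hδ, hδ1⟩ := Metric.eventually_nhds_iff.1 h1
  set t := min (min ε δ) 1 / 2 with ht
  have hm : 0 < min (min ε δ) 1 := by positivity
  have ht0 : 0 < t := half_pos hm
  have htm : t < min (min ε δ) 1 := half_lt_self hm
  have htε : t < ε := htm.trans_le ((min_le_left _ _).trans (min_le_left _ _))
  have htδ : t < δ := htm.trans_le ((min_le_left _ _).trans (min_le_right _ _))
  have ht1 : t < 1 := htm.trans_le (min_le_right _ _)
  have h2 := hδ1 (y := t) (by simpa [abs_of_pos ht0] using htδ)
  simp only [sub_zero, hx0, Real.norm_eq_abs, abs_of_pos ht0] at h2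
  refine ⟨t, ⟨ht0, htε⟩, ?_⟩
  rw [Metric.mem_ball, dist_eq_norm]
  have h3 : x t - q = (x t - p - t • (q - p)) + (1 - t) • (p - q) := by module
  have h4 : ‖(1 - t) • (p - q)‖ = (1 - t) * dist p q := by
    rw [norm_smul, Real.norm_eq_abs, abs_of_pos (by linarith), dist_eq_norm]
  calc ‖x t - q‖ ≤ dist p q / 2 * t + (1 - t) * dist p q := by
        rw [h3, ← h4]
        exact (norm_add_le _ _).trans (by gcongr)
    _ < dist p q := by nlinarith

end Propagation

section Rigidity

open Set

variable {n : ℕ} {U : Set (Fin n → ℝ)} {g g' : (Fin n → ℝ) → Matrix (Fin n) (Fin n) ℝ}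

/-- Painlevé's first integral of two metrics. -/
noncomputable def painleve (g g' : (Fin n → ℝ) → Matrix (Fin n) (Fin n) ℝ) (p v : Fin n → ℝ) : ℝ :=
  (n + 1) * (Real.log (v ⬝ᵥ g' p *ᵥ v) - Real.log (v ⬝ᵥ g p *ᵥ v))
    - 2 * (Real.log (g' p).det - Real.log (g p).det)

lemma painleve_of_eq_smul {p : Fin n → ℝ} (hg : (g p).PosDef) {k : ℝ} (hk : 0 < k)
    (h : g' p = k • g p) {v : Fin n → ℝ} (hv : v ≠ 0) :
    painleve g g' p v = (1 - n) * Real.log k := by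
  have h1 := (hg.quadratic_pos hv).ne'
  rw [painleve, h, smul_mulVec, dotProduct_smul, smul_eq_mul, Real.log_mul hk.ne' h1, det_smul,
    Real.log_mul (pow_pos hk _).ne' hg.det_pos.ne', Real.log_pow, Fintype.card_fin]
  ring

lemma randersAcc_zero (p v : Fin n → ℝ) :
    randersAcc g (fun _ => 0) p v = -spray (g p) (partials g p) v := by
  have : dform (fun _ : Fin n → ℝ => (0 : Fin n → ℝ)) p = 0 := by
    ext i j
    simp [dform, dpart]
  simp [randersAcc, this]

lemma exists_painleve_flow (hU : IsOpen U) (h : IsRandersDatum U g fun _ => 0)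
    (h' : IsRandersDatum U g' fun _ => 0)
    (hproj : ∀ p ∈ U, ∀ v ≠ 0, ∃ c : ℝ,
      spray (g' p) (partials g' p) v - spray (g p) (partials g p) v = c • v)
    {p v : Fin n → ℝ} (hp : p ∈ U) (hv : v ≠ 0) :
    ∃ ε > (0 : ℝ), ∃ S ∈ nhds (p, v), ∃ α : (Fin n → ℝ) × (Fin n → ℝ) → ℝ →
      (Fin n → ℝ) × (Fin n → ℝ), α (p, v) 0 = (p, v) ∧
      HasDerivAt (fun t => (α (p, v) t).1) v 0 ∧
      (∀ t ∈ Ioo (-ε) ε, ContinuousAt (fun z => α z t) (p, v)) ∧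
      ∀ z ∈ S, ∀ t ∈ Ioo (-ε) ε, (α z t).2 ≠ 0 ∧
        painleve g g' (α z t).1 (α z t).2 = painleve g g' z.1 z.2 := by
  have hW : phaseSpace U ∈ nhds (p, v) := (isOpen_phaseSpace hU).mem_nhds ⟨hp, hv⟩
  obtain ⟨ε, hε, S, hS, α, h0, hα, hc⟩ :=
    exists_local_flow hW ((contDiffOn_randersAcc hU h).contDiffAt hW)
  have h0mem : (0 : ℝ) ∈ Ioo (-ε) ε := by simp [hε]
  have hx : ∀ z ∈ S, ∀ t ∈ Ioo (-ε) ε, HasDerivAt (fun t => (α z t).1) (α z t).2 t :=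
    fun z hz t ht => (ContinuousLinearMap.fst ℝ (Fin n → ℝ) (Fin n → ℝ)).hasFDerivAt.comp_hasDerivAt
      t (hα z hz t ht).1
  have hy : ∀ z ∈ S, ∀ t ∈ Ioo (-ε) ε, HasDerivAt (fun t => (α z t).2)
      (-spray (g (α z t).1) (partials g (α z t).1) (α z t).2) t := by
    intro z hz t ht
    rw [← randersAcc_zero]
    exact (ContinuousLinearMap.snd ℝ (Fin n → ℝ) (Fin n → ℝ)).hasFDerivAt.comp_hasDerivAt
      t (hα z hz t ht).1
  have hpS := mem_of_mem_nhds hS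
  have hx0 := hx _ hpS 0 h0mem
  have hz0 := h0 _ hpS
  rw [hz0] at hx0
  refine ⟨ε, hε, S, hS, α, hz0, hx0, hc, fun z hz t ht => ⟨(hα z hz t ht).2.2, ?_⟩⟩
  have hJ : ∀ s ∈ Ioo (-ε) ε,
      HasDerivAt (fun s => painleve g g' (α z s).1 (α z s).2) 0 s := fun s hs =>
    hasDerivAt_painleve hU (fun p hp => (h.1 p hp).1) (fun p hp => (h'.1 p hp).1)
      (fun p hp => (h.1 p hp).2) (fun p hp => (h'.1 p hp).2)
      (fun p hp => differentiableAt_of_isRandersDatum hU h hp)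
      (fun p hp => differentiableAt_of_isRandersDatum hU h' hp) hproj
      (x := fun s => (α z s).1) (y := fun s => (α z s).2)
      (hα z hz s hs).2.1 (hα z hz s hs).2.2 (hx z hz s hs) (hy z hz s hs)
  have := isOpen_Ioo.is_const_of_deriv_eq_zero isPreconnected_Ioo
    (fun s hs => (hJ s hs).differentiableAt.differentiableWithinAt)
    (fun s hs => (hJ s hs).deriv) ht h0mem
  simpa [h0 z hz] using this

/-- Conformal metrics with the same unparametrized geodesics are locally homothetic. -/
lemma exists_ball_homothety (hn : 2 ≤ n) (hU : IsOpen U) (h : IsRandersDatum U g fun _ => 0)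
    (h' : IsRandersDatum U g' fun _ => 0)
    (hproj : ∀ p ∈ U, ∀ v ≠ 0, ∃ c : ℝ,
      spray (g' p) (partials g' p) v - spray (g p) (partials g p) v = c • v)
    {p : Fin n → ℝ} (hp : p ∈ U) (hconf : ∀ᶠ q in nhds p, ∃ k : ℝ, 0 < k ∧ g' q = k • g q) :
    ∃ C > (0 : ℝ), ∀ᶠ q in nhds p, g' q = C • g q := by
  obtain ⟨δ, hδ, hball⟩ := Metric.eventually_nhds_iff_ball.1 (hconf.and (hU.mem_nhds hp))
  set i₀ : Fin n := ⟨0, by omega⟩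
  have he : (Pi.single i₀ 1 : Fin n → ℝ) ≠ 0 := by simp
  have hpos : ∀ q ∈ Metric.ball p δ, 0 < g q i₀ i₀ := fun q hq => by
    simpa using (h.1 q (hball q hq).2).2.quadratic_pos he
  set κ : (Fin n → ℝ) → ℝ := fun q => g' q i₀ i₀ / g q i₀ i₀ with hκ
  have hκg : ∀ q ∈ Metric.ball p δ, 0 < κ q ∧ g' q = κ q • g q := by
    intro q hq
    obtain ⟨⟨k, hk, hkg⟩, -⟩ := hball q hq
    have : κ q = k := by
      simp only [hκ, hkg, Matrix.smul_apply, smul_eq_mul]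
      exact mul_div_cancel_right₀ _ (hpos q hq).ne'
    rw [this]
    exact ⟨hk, hkg⟩
  have hdiff : ∀ q ∈ Metric.ball p δ, DifferentiableAt ℝ (fun q => Real.log (κ q)) q := by
    intro q hq
    refine DifferentiableAt.log ?_ (hκg q hq).1.ne'
    have h1 := differentiableAt_of_isRandersDatum hU h' (hball q hq).2 i₀ i₀
    have h2 := differentiableAt_of_isRandersDatum hU h (hball q hq).2 i₀ i₀
    simp only [hκ, div_eq_mul_inv]
    exact h1.fun_mul (h2.fun_inv (hpos q hq).ne')
  have hn1 : (1 - n : ℝ) ≠ 0 := by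
    have : (2 : ℝ) ≤ n := by exact_mod_cast hn
    linarith
  have hzero : ∀ q ∈ Metric.ball p δ, fderiv ℝ (fun q => Real.log (κ q)) q = 0 := by
    intro q hq
    ext1 v
    by_cases hv : v = 0
    · simp [hv]
    obtain ⟨ε, hε, S, hS, α, hα0, hαd, -, hα⟩ :=
      exists_painleve_flow hU h h' hproj (hball q hq).2 hv
    have h1 : HasDerivAt (fun t => Real.log (κ (α (q, v) t).1))
        (fderiv ℝ (fun q => Real.log (κ q)) q v) 0 := by
      refine HasFDerivAt.comp_hasDerivAt (l := fun q => Real.log (κ q)) (0 : ℝ) ?_ hαd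
      rw [hα0]
      exact (hdiff q hq).hasFDerivAt
    have h2 : (fun t => Real.log (κ (α (q, v) t).1)) =ᶠ[nhds 0]
        fun _ => (1 - n : ℝ)⁻¹ * painleve g g' q v := by
      have hc : ∀ᶠ t in nhds (0 : ℝ), (α (q, v) t).1 ∈ Metric.ball p δ :=
        hαd.continuousAt.preimage_mem_nhds (Metric.isOpen_ball.mem_nhds (by rwa [hα0]))
      have hI : Ioo (-ε) ε ∈ nhds (0 : ℝ) := isOpen_Ioo.mem_nhds (by simp [hε])
      filter_upwards [hc, hI] with t ht htI
      obtain ⟨hy0, hJ⟩ := hα _ (mem_of_mem_nhds hS) t htI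
      rw [painleve_of_eq_smul (h.1 _ (hball _ ht).2).2 (hκg _ ht).1 (hκg _ ht).2 hy0] at hJ
      rw [← hJ, inv_mul_cancel_left₀ hn1]
    rw [← h1.deriv, h2.deriv_eq]
    simp
  refine ⟨κ p, (hκg p (Metric.mem_ball_self hδ)).1, ?_⟩
  filter_upwards [Metric.ball_mem_nhds p hδ] with q hq
  have hlog : Real.log (κ q) = Real.log (κ p) :=
    Metric.isOpen_ball.is_const_of_fderiv_eq_zero (convex_ball p δ).isPreconnected
      (fun q hq => (hdiff q hq).differentiableWithinAt) (fun q hq => hzero q hq) hq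
      (Metric.mem_ball_self hδ)
  rw [(hκg q hq).2,
    Real.log_injOn_pos (hκg q hq).1 (hκg p (Metric.mem_ball_self hδ)).1 hlog]

/-- A homothety between metrics with the same unparametrized geodesics on a nonempty open subset
extends to the whole connected domain. -/
lemma homothety_of_eventually (hn : 2 ≤ n) (hU : IsOpen U) (hUc : IsPreconnected U)
    (h : IsRandersDatum U g fun _ => 0) (h' : IsRandersDatum U g' fun _ => 0)
    (hproj : ∀ p ∈ U, ∀ v ≠ 0, ∃ c : ℝ,
      spray (g' p) (partials g' p) v - spray (g p) (partials g p) v = c • v)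
    {C : ℝ} (hC : 0 < C) {p₀ : Fin n → ℝ} (hp₀ : p₀ ∈ U)
    (hp₀C : ∀ᶠ q in nhds p₀, g' q = C • g q) : ∀ p ∈ U, g' p = C • g p := by
  set O : Set (Fin n → ℝ) := interior {q | q ∈ U ∧ g' q = C • g q} with hOdef
  have hOsub : ∀ q ∈ O, q ∈ U ∧ g' q = C • g q := by
    intro q hq
    have : q ∈ {q | q ∈ U ∧ g' q = C • g q} := interior_subset hq
    exact this
  have hn1 : (1 - n : ℝ) ≠ 0 := by
    have : (2 : ℝ) ≤ n := by exact_mod_cast hn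
    linarith
  suffices U ⊆ O from fun p hp => (hOsub p (this hp)).2
  refine subset_of_touching_balls hU hUc isOpen_interior
    ⟨p₀, hp₀, mem_interior_iff_mem_nhds.2 ((hU.eventually_mem hp₀).and hp₀C)⟩ ?_
  intro p hp q hpq hball
  have hv : q - p ≠ 0 := sub_ne_zero.2 hpq.symm
  obtain ⟨ε, hε, S, hS, α, hα0, hαd, hαc, hα⟩ := exists_painleve_flow hU h h' hproj hp hv
  obtain ⟨t, ht, htq⟩ := exists_pos_mem_ball hpq (by simp [hα0]) hαd hε
  have htI : t ∈ Ioo (-ε) ε := ⟨by linarith [ht.1], ht.2⟩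
  have hnear : ∀ᶠ z in nhds (p, q - p), painleve g g' z.1 z.2 = (1 - n) * Real.log C := by
    have hO : ∀ᶠ z in nhds (p, q - p), (α z t).1 ∈ O :=
      (continuous_fst.continuousAt.comp (hαc t htI)).preimage_mem_nhds
        (isOpen_interior.mem_nhds (hball htq))
    filter_upwards [hO, hS] with z hz hzS
    obtain ⟨hy0, hJ⟩ := hα z hzS t htI
    rw [← hJ]
    exact painleve_of_eq_smul (h.1 _ (hOsub _ hz).1).2 hC (hOsub _ hz).2 hy0
  rw [nhds_prod_eq] at hnear
  rw [hOdef, mem_interior_iff_mem_nhds]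
  filter_upwards [hnear.curry, hU.mem_nhds hp] with x hx hxU
  refine ⟨hxU, ?_⟩
  set κ : ℝ := Real.exp (((1 - n) * Real.log C
    + 2 * (Real.log (g' x).det - Real.log (g x).det)) / (n + 1)) with hκ
  have hκpos : 0 < κ := Real.exp_pos _
  have hn2 : (n + 1 : ℝ) ≠ 0 := by positivity
  have hquad : ∀ᶠ w in nhds (q - p), w ⬝ᵥ (g' x - κ • g x) *ᵥ w = 0 := by
    filter_upwards [hx, isOpen_ne.mem_nhds hv] with w hw hw0
    have hN := (h.1 x hxU).2.quadratic_pos hw0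
    have hN' := (h'.1 x hxU).2.quadratic_pos hw0
    rw [painleve] at hw
    have h1 : Real.log (w ⬝ᵥ g' x *ᵥ w) = Real.log (κ * (w ⬝ᵥ g x *ᵥ w)) := by
      rw [Real.log_mul hκpos.ne' hN.ne', hκ, Real.log_exp, ← hw]
      field_simp
      ring
    rw [sub_mulVec, smul_mulVec, dotProduct_sub, dotProduct_smul, smul_eq_mul,
      Real.log_injOn_pos hN' (mul_pos hκpos hN) h1, sub_self]
  have hκg : g' x = κ • g x := by
    refine sub_eq_zero.1 (Matrix.IsSymm.eq_zero_of_eventually_quadratic_eq_zero ?_ hquad)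
    exact (h'.1 x hxU).1.sub ((h.1 x hxU).1.smul κ)
  have hJ := hx.self_of_nhds
  rw [painleve_of_eq_smul (h.1 x hxU).2 hκpos hκg hv] at hJ
  rw [hκg, Real.log_injOn_pos hκpos hC (mul_left_cancel₀ hn1 hJ)]

end Rigidity
section Pullback

variable {n : ℕ} {U : Set (Fin n → ℝ)} {φ : (Fin n → ℝ) → Fin n → ℝ}

lemma jacobian_mulVec {p : Fin n → ℝ} (hφ : DifferentiableAt ℝ φ p) (v : Fin n → ℝ) :
    jacobian φ p *ᵥ v = fderiv ℝ φ p v := by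
  ext i
  have h1 : fderiv ℝ φ p v i = fderiv ℝ (fun q => φ q i) p v := by
    rw [fderiv_pi (fun i => differentiableAt_pi.1 hφ i)]
    rfl
  rw [h1, fderiv_eq_sum_dpart]
  simp only [mulVec, dotProduct, jacobian, of_apply]
  exact Finset.sum_congr rfl fun k _ => mul_comm _ _

lemma jacobian_mulVec_injective {ψ : (Fin n → ℝ) → Fin n → ℝ} {p : Fin n → ℝ}
    (hφ : DifferentiableAt ℝ φ p) (hψ : DifferentiableAt ℝ ψ (φ p))
    (h : ∀ᶠ q in nhds p, ψ (φ q) = q) : Function.Injective (jacobian φ p).mulVec := by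
  have h1 : (fderiv ℝ ψ (φ p)).comp (fderiv ℝ φ p) = ContinuousLinearMap.id ℝ _ := by
    have h2 : ψ ∘ φ =ᶠ[nhds p] id := h
    rw [← fderiv_comp p hψ hφ, h2.fderiv_eq, fderiv_id]
  intro v w hvw
  simp only [jacobian_mulVec hφ] at hvw
  simpa [hvw] using (congrArg (fun L => L v) h1).symm.trans
    ((congrArg (fderiv ℝ ψ (φ p)) hvw).trans (congrArg (fun L => L w) h1))

/-- The pullback of a metric under a diffeomorphism is again a metric. -/
lemma isRandersDatum_pullback (hU : IsOpen U) {g : (Fin n → ℝ) → Matrix (Fin n) (Fin n) ℝ}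
    {ω : (Fin n → ℝ) → Fin n → ℝ} (h : IsRandersDatum U g ω) {ψ : (Fin n → ℝ) → Fin n → ℝ}
    (hφ : ∀ i, ContDiffOn ℝ 3 (fun q => φ q i) U) (hφU : Set.MapsTo φ U U)
    (hψ : ∀ i, ContDiffOn ℝ 3 (fun q => ψ q i) U) (hleft : ∀ p ∈ U, ψ (φ p) = p) :
    IsRandersDatum U (fun p => (jacobian φ p)ᵀ * g (φ p) * jacobian φ p) fun _ => 0 := by
  have hφ' : ContDiffOn ℝ 3 φ U := contDiffOn_pi.2 hφ
  have hψ' : ContDiffOn ℝ 3 ψ U := contDiffOn_pi.2 hψ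
  refine ⟨fun p hp => ⟨?_, ?_⟩, fun i j => ?_, fun i => contDiffOn_const⟩
  · have hs : (g (φ p))ᵀ = g (φ p) := (h.1 _ (hφU hp)).1
    change ((jacobian φ p)ᵀ * g (φ p) * jacobian φ p)ᵀ = (jacobian φ p)ᵀ * g (φ p) * jacobian φ p
    rw [transpose_mul, transpose_mul, transpose_transpose, hs, mul_assoc]
  · change ((jacobian φ p)ᵀ * g (φ p) * jacobian φ p).PosDef
    rw [← conjTranspose_eq_transpose_of_trivial]
    refine (h.1 _ (hφU hp)).2.conjTranspose_mul_mul_same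
      (jacobian_mulVec_injective (ψ := ψ)
        ((hφ'.differentiableOn three_ne_zero).differentiableAt (hU.mem_nhds hp))
        ((hψ'.differentiableOn three_ne_zero).differentiableAt (hU.mem_nhds (hφU hp))) ?_)
    filter_upwards [hU.mem_nhds hp] with q hq using hleft q hq
  · have hJ : ∀ i j, ContDiffOn ℝ 2 (fun q => jacobian φ q i j) U := fun i j =>
      ContDiffOn.dpart hU (by norm_num [two_add_one_eq_three]) (hφ i) j
    have hg : ∀ i j, ContDiffOn ℝ 2 (fun q => g (φ q) i j) U := fun i j =>
      (h.2.1 i j).comp (hφ'.of_le (by norm_num)) hφU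
    simp only [mul_apply, transpose_apply]
    exact ContDiffOn.sum fun k _ =>
      (ContDiffOn.sum fun l _ => (hJ l i).mul (hg l k)).mul (hJ k j)

end Pullback

lemma eventually_dform_ne_zero {n : ℕ} {U : Set (Fin n → ℝ)} (hU : IsOpen U)
    {ω : (Fin n → ℝ) → Fin n → ℝ} (hω : ∀ i, ContDiffOn ℝ 2 (fun q => ω q i) U)
    {p : Fin n → ℝ} (hp : p ∈ U) (h : dform ω p ≠ 0) : ∀ᶠ q in nhds p, dform ω q ≠ 0 := by
  obtain ⟨i, j, hij⟩ : ∃ i j, dform ω p i j ≠ 0 := by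
    by_contra! hcon
    exact h (by ext i j; exact hcon i j)
  have hd : ∀ i k, ContDiffOn ℝ 1 (fun q => dpart (fun r => ω r i) k q) U := fun i k =>
    ContDiffOn.dpart hU (by norm_num [one_add_one_eq_two]) (hω i) k
  have hc : ContinuousAt (fun q => dform ω q i j) p :=
    ((hd i j).sub (hd j i)).continuousOn.continuousAt (hU.mem_nhds hp)
  filter_upwards [hc.eventually_ne hij] with q hq hq0
  exact hq (by simp [hq0])

/-- Corollary 1 of the paper: a projective transformation of a Randers datum `(g, ω)` with
`ω` not closed is a homothety of `g`. -/
theorem stmt_15 (n : ℕ) (hn : 2 ≤ n) (U : Set (Fin n → ℝ))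
    (hUopen : IsOpen U) (hUconn : IsConnected U)
    (g : (Fin n → ℝ) → Matrix (Fin n) (Fin n) ℝ)
    (ω : (Fin n → ℝ) → (Fin n → ℝ))
    (hdatum : IsRandersDatum U g ω)
    (φ ψ : (Fin n → ℝ) → (Fin n → ℝ))
    (hφsmooth : ∀ i, ContDiffOn ℝ 3 (fun q => φ q i) U)
    (hφmaps : Set.MapsTo φ U U)
    (hψsmooth : ∀ i, ContDiffOn ℝ 3 (fun q => ψ q i) U)
    (hψmaps : Set.MapsTo ψ U U)
    (hleft : ∀ p ∈ U, ψ (φ p) = p) (hright : ∀ p ∈ U, φ (ψ p) = p)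
    (hproj : ∀ (I : Set ℝ) (x : ℝ → (Fin n → ℝ)),
      IsRandersGeodesic U g ω I x →
        IsRandersGeodesic U
          (fun p => (jacobian φ p)ᵀ * g (φ p) * jacobian φ p)
          (fun p => (jacobian φ p)ᵀ.mulVec (ω (φ p))) I x)
    (hnotclosed : ¬ IsClosedFormOn U ω) :
    ∃ c : ℝ, 0 < c ∧
      ∀ p ∈ U, (jacobian φ p)ᵀ * g (φ p) * jacobian φ p = (c ^ 2) • g p := by
  have h : IsRandersDatum U g fun _ => 0 := ⟨hdatum.1, hdatum.2.1, fun _ => contDiffOn_const⟩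
  have h' := isRandersDatum_pullback hUopen hdatum hφsmooth hφmaps hψsmooth hleft
  have hpar := fun p hp => spray_and_magnetic_parallel hUopen hdatum
    (fun p hp => (h'.1 p hp).2) hproj (p := p) hp
  obtain ⟨p, hp, hdω⟩ : ∃ p ∈ U, dform ω p ≠ 0 := by
    simpa [IsClosedFormOn] using hnotclosed
  have hconf : ∀ᶠ q in nhds p, ∃ k : ℝ, 0 < k ∧
      (jacobian φ q)ᵀ * g (φ q) * jacobian φ q = k • g q := by
    filter_upwards [hUopen.mem_nhds hp, eventually_dform_ne_zero hUopen hdatum.2.2 hp hdω]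
      with q hq hq0
    exact exists_eq_smul_of_magnetic_parallel (hdatum.1 q hq).2 (h'.1 q hq).2 (hdatum.1 q hq).1
      (h'.1 q hq).1 (transpose_dform ω q) hq0 (hpar q hq).2
  have hspray := fun p hp => (hpar p hp).1
  obtain ⟨C, hC, hloc⟩ := exists_ball_homothety hn hUopen h h' hspray hp hconf
  refine ⟨√C, Real.sqrt_pos.2 hC, fun q hq => ?_⟩
  rw [Real.sq_sqrt hC.le]
  exact homothety_of_eventually hn hUopen hUconn.isPreconnected h h' hspray hC hp hloc q hq
end

section
/- Let (g, ω) be a Randers datum on an open set U ⊆ ℝⁿ (n ≥ 2), let p ∈ U and let ξ ∈ ℝⁿ be a nonzero vector with (dω)_p ξ ≠ 0, where (dω)_p is the skew-symmetric matrix with entries (∂ω_i/∂x^k)(p) − (∂ω_k/∂x^i)(p). Let x : I → U be a forward Randers geodesic of (g, ω) and let x̃ : Ĩ → U be a forward Randers geodesic of (g, −ω), both defined on open intervals containing 0, with x(0) = x̃(0) = p and ẋ(0) = ẋ̃(0) = ξ. Then the difference of accelerations ẍ(0) − ẍ̃(0) is not a scalar multiple of ξ. -/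
open Matrix

theorem dpart_neg_apply {n : ℕ} (ω : (Fin n → ℝ) → (Fin n → ℝ)) (i k : Fin n)
    (p : Fin n → ℝ) : dpart (fun q => (-(ω q)) i) k p = -dpart (fun q => ω q i) k p := by
  simp only [dpart, Pi.neg_apply, fderiv_fun_neg, _root_.neg_apply]

/-- The value of the skew-symmetric form `dω` on a repeated vector vanishes. -/
theorem dotProduct_dform_mulVec_self {n : ℕ} (ω : (Fin n → ℝ) → (Fin n → ℝ))
    (p ξ : Fin n → ℝ) : ξ ⬝ᵥ (dform ω p).mulVec ξ = 0 := by
  have hskew : (dform ω p)ᵀ = -dform ω p := by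
    ext i k
    simp [dform]
  have h : ξ ⬝ᵥ (dform ω p).mulVec ξ = -(ξ ⬝ᵥ (dform ω p).mulVec ξ) := by
    conv_lhs => rw [dotProduct_mulVec, ← mulVec_transpose, hskew, neg_mulVec, neg_dotProduct,
      dotProduct_comm]
  linarith

/-- A skew form is never a nonzero multiple of a positive definite one along a vector. -/
theorem dform_mulVec_eq_zero_of_inv_mulVec_eq_smul {n : ℕ} {G : Matrix (Fin n) (Fin n) ℝ}
    (hG : G.PosDef) (ω : (Fin n → ℝ) → (Fin n → ℝ)) (p : Fin n → ℝ) {ξ : Fin n → ℝ}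
    (hξ : ξ ≠ 0) {c : ℝ} (h : G⁻¹.mulVec ((dform ω p).mulVec ξ) = c • ξ) :
    (dform ω p).mulVec ξ = 0 := by
  have hdet : IsUnit G.det := hG.det_pos.ne'.isUnit
  have hΩ : (dform ω p).mulVec ξ = c • G.mulVec ξ := by
    rw [← mulVec_smul, ← h, mulVec_mulVec, mul_nonsing_inv _ hdet, one_mulVec]
  have hpos : 0 < ξ ⬝ᵥ G.mulVec ξ := by simpa using hG.dotProduct_mulVec_pos hξ
  have hzero := dotProduct_dform_mulVec_self ω p ξ
  rw [hΩ, dotProduct_smul, smul_eq_mul] at hzero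
  rw [hΩ, (mul_eq_zero.mp hzero).resolve_right hpos.ne', zero_smul]

theorem mulVec_dform_mulVec_apply {n : ℕ} (A : Matrix (Fin n) (Fin n) ℝ)
    (ω : (Fin n → ℝ) → (Fin n → ℝ)) (p ξ : Fin n → ℝ) (j : Fin n) :
    A.mulVec ((dform ω p).mulVec ξ) j = ∑ i, ∑ k, A j i *
      (dpart (fun q => ω q i) k p - dpart (fun q => ω q k) i p) * ξ k := by
  simp [mulVec, dotProduct, dform, Finset.mul_sum, mul_assoc]

/-- At a point where `(dω)ξ ≠ 0`, the forward geodesic of `(g, ω)` and the forward geodesic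
of `(g, −ω)` issued with the same initial velocity `ξ` have accelerations whose difference is
not proportional to `ξ`. -/
theorem stmt_16 (n : ℕ) (hn : 2 ≤ n) (U : Set (Fin n → ℝ)) (hUopen : IsOpen U)
    (g : (Fin n → ℝ) → Matrix (Fin n) (Fin n) ℝ)
    (ω : (Fin n → ℝ) → (Fin n → ℝ))
    (hdatum : IsRandersDatum U g ω)
    (p : Fin n → ℝ) (hp : p ∈ U)
    (ξ : Fin n → ℝ) (hξ : ξ ≠ 0) (hdω : (dform ω p).mulVec ξ ≠ 0)
    (I Itilde : Set ℝ) (x xtilde : ℝ → (Fin n → ℝ))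
    (hgeo : IsRandersGeodesic U g ω I x)
    (hgeotilde : IsRandersGeodesic U g (fun q => -(ω q)) Itilde xtilde)
    (h0I : (0 : ℝ) ∈ I) (h0Itilde : (0 : ℝ) ∈ Itilde)
    (hx0 : x 0 = p) (hxtilde0 : xtilde 0 = p)
    (hv : deriv x 0 = ξ) (hvtilde : deriv xtilde 0 = ξ) :
    ∀ c : ℝ, deriv (deriv x) 0 - deriv (deriv xtilde) 0 ≠ c • ξ := by
  intro c hc
  obtain ⟨-, -, -, -, -, hE⟩ := hgeo
  obtain ⟨-, -, -, -, -, hE'⟩ := hgeotilde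
  set S := Real.sqrt (∑ k, ∑ m, g p k m * ξ k * ξ m)
  set d := deriv (fun s => 1 / Real.sqrt (∑ k, ∑ m, g (x s) k m * deriv x s k * deriv x s m)) 0
  set d' := deriv (fun s => 1 / Real.sqrt (∑ k, ∑ m, g (xtilde s) k m *
    deriv xtilde s k * deriv xtilde s m)) 0
  refine hdω (dform_mulVec_eq_zero_of_inv_mulVec_eq_smul (hdatum.1 p hp).2 ω p hξ
    (c := -(c / S + (d - d')) / 2) ?_)
  ext j
  have h := hE 0 h0I j
  have h' := hE' 0 h0Itilde j
  have hcj : deriv (deriv x) 0 j - deriv (deriv xtilde) 0 j = c * ξ j := congrFun hc j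
  have hneg : ∑ i, ∑ k, (g p)⁻¹ j i * (dpart (fun q => (-(ω q)) i) k p -
      dpart (fun q => (-(ω q)) k) i p) * ξ k = -(g p)⁻¹.mulVec ((dform ω p).mulVec ξ) j := by
    rw [mulVec_dform_mulVec_apply, ← Finset.sum_neg_distrib]
    refine Finset.sum_congr rfl fun i _ => ?_
    rw [← Finset.sum_neg_distrib]
    refine Finset.sum_congr rfl fun k _ => ?_
    rw [dpart_neg_apply, dpart_neg_apply]
    ring
  rw [hx0, hv, ← mulVec_dform_mulVec_apply] at h
  rw [hxtilde0, hvtilde, hneg] at h'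
  have hdiv : deriv (deriv x) 0 j / S - deriv (deriv xtilde) 0 j / S = c / S * ξ j := by
    rw [← sub_div, hcj]
    ring
  rw [Pi.smul_apply, smul_eq_mul]
  linarith
end
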